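/- Assume (H₀), (Hᴵ₁), (Hᴵ₂), and that (Hᴵ₃) holds for at least one σ. Let σ* := sup{σ ∈ (g₀,+∞) : (Hᴵ₃) holds for σ}. Then there exists s₀ ∈ (−∞, σ*) such that: for s₀ < s < σ*, equation (E_s) has at least one T-periodic solution, and for s < s₀, equation (E_s) has no T-periodic solutions. Moreover, if (Hᴵ₄) holds for at least one σ, let σ** := sup{σ ∈ (g₀, σ*] : (Hᴵ₄) holds for σ}; then for s = s₀ equation (E_s) has at least one T-periodic solution, and for s₀ < s < σ** equation (E_s) has at least two T-periodic solutions. -/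

import Mathlib

open MeasureTheory Set Filter

noncomputable section

/-- The Lebesgue measure restricted to the interval `[0,T]`. -/
def muT (T : ℝ) : Measure ℝ := volume.restrict (Icc 0 T)

/-- `u` is a `C¹` function on `[0,T]` with derivative `u'` there, satisfying the
`T`-periodic boundary conditions `u 0 = u T` and `u' 0 = u' T`. -/
def IsC1Periodic (T : ℝ) (u u' : ℝ → ℝ) : Prop :=
  (∀ t ∈ Icc (0:ℝ) T, HasDerivWithinAt u (u' t) (Icc (0:ℝ) T) t) ∧
    ContinuousOn u' (Icc (0:ℝ) T) ∧ u 0 = u T ∧ u' 0 = u' T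

/-- `φ ∘ u'` is absolutely continuous on `[0,T]`, being the indefinite integral of the
integrable function `w` (which is then its a.e. derivative). -/
def IsACPhiDeriv (T : ℝ) (φ : ℝ → ℝ) (u' w : ℝ → ℝ) : Prop :=
  IntegrableOn w (Icc (0:ℝ) T) ∧
    ∀ t ∈ Icc (0:ℝ) T, φ (u' t) = φ (u' 0) + ∫ τ in (0:ℝ)..t, w τ

/-- `h : [0,T] × ℝ → ℝ` is a Carathéodory function: measurable in `t`, continuous in `u`
for a.e. `t`, and locally `L¹`-dominated. -/
def Caratheodory (T : ℝ) (h : ℝ → ℝ → ℝ) : Prop :=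
  (∀ u : ℝ, Measurable fun t => h t u) ∧
    (∀ᵐ t ∂(muT T), Continuous fun u => h t u) ∧
    ∀ r : ℝ, 0 < r → ∃ γ : ℝ → ℝ, IntegrableOn γ (Icc (0:ℝ) T) ∧
      ∀ᵐ t ∂(muT T), ∀ u : ℝ, |u| ≤ r → |h t u| ≤ γ t

/-- `u` is a `T`-periodic solution of `(φ(u'))' + f(u)u' + h(t,u) = 0`. -/
def IsSolE (T : ℝ) (φ f : ℝ → ℝ) (h : ℝ → ℝ → ℝ) (u : ℝ → ℝ) : Prop :=
  ∃ u' w : ℝ → ℝ, IsC1Periodic T u u' ∧ IsACPhiDeriv T φ u' w ∧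
    ∀ᵐ t ∂(muT T), w t + f (u t) * u' t + h t (u t) = 0

/-- Condition `(A₀)`: local uniform control of `h(t,u) − h(t,u₀)` for a.e. `t`. -/
def CondA0 (T : ℝ) (h : ℝ → ℝ → ℝ) : Prop :=
  ∀ t₀ ∈ Icc (0:ℝ) T, ∀ u₀ : ℝ, ∀ ε : ℝ, 0 < ε → ∃ δ : ℝ, 0 < δ ∧
    ∀ᵐ t ∂(muT T), |t - t₀| < δ → ∀ u : ℝ, |u - u₀| < δ → |h t u - h t u₀| < ε

/-- `u` is a `T`-periodic solution of `(φ(u'))' + f(u)u' + g(t,u) = s`. -/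
def IsSolEs (T : ℝ) (φ f : ℝ → ℝ) (g : ℝ → ℝ → ℝ) (s : ℝ) (u : ℝ → ℝ) : Prop :=
  ∃ u' w : ℝ → ℝ, IsC1Periodic T u u' ∧ IsACPhiDeriv T φ u' w ∧
    ∀ᵐ t ∂(muT T), w t + f (u t) * u' t + g t (u t) = s

/-- Condition `(Hᴵ₃)` for `σ`: `σ > max{0,g₀}` and the mean of `g(t,u(t))` exceeds `σ`
for every `u ∈ C¹_T` with `u ≤ −d`. -/
def HI3 (T : ℝ) (g : ℝ → ℝ → ℝ) (g₀ σ : ℝ) : Prop :=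
  max 0 g₀ < σ ∧ ∃ d : ℝ, 0 < d ∧ ∀ u u' : ℝ → ℝ, IsC1Periodic T u u' →
    (∀ t ∈ Icc (0:ℝ) T, u t ≤ -d) → σ < (1 / T) * ∫ t in Icc (0:ℝ) T, g t (u t)

/-- Condition `(Hᴵ₄)` for `σ`: `σ > max{0,g₀}` and the mean of `g(t,u(t))` exceeds `σ`
for every `u ∈ C¹_T` with `u ≥ d`. -/
def HI4 (T : ℝ) (g : ℝ → ℝ → ℝ) (g₀ σ : ℝ) : Prop :=
  max 0 g₀ < σ ∧ ∃ d : ℝ, 0 < d ∧ ∀ u u' : ℝ → ℝ, IsC1Periodic T u u' →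
    (∀ t ∈ Icc (0:ℝ) T, d ≤ u t) → σ < (1 / T) * ∫ t in Icc (0:ℝ) T, g t (u t)

/-- `σ* = sup{σ ∈ (g₀,+∞) : (Hᴵ₃) holds for σ}`, as an extended real number. -/
def sigmaStar (T : ℝ) (g : ℝ → ℝ → ℝ) (g₀ : ℝ) : EReal :=
  sSup {x : EReal | ∃ σ : ℝ, x = (σ : EReal) ∧ HI3 T g g₀ σ}

/-- `σ** = sup{σ ∈ (g₀,σ*] : (Hᴵ₄) holds for σ}`, as an extended real number. -/
def sigmaStarStar (T : ℝ) (g : ℝ → ℝ → ℝ) (g₀ : ℝ) : EReal :=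
  sSup {x : EReal | ∃ σ : ℝ, x = (σ : EReal) ∧ HI4 T g g₀ σ ∧
    (σ : EReal) ≤ sigmaStar T g g₀}

section

open scoped Topology

/-- A continuous function that avoids both endpoints of an interval and starts inside it
stays inside it. -/
theorem mem_Ioo_of_avoids {k : ℝ → ℝ} {x y l m : ℝ} (hk : Continuous k)
    (hl : ∀ t ∈ uIcc x y, k t ≠ l) (hm : ∀ t ∈ uIcc x y, k t ≠ m) (hx : k x ∈ Ioo l m) :
    k y ∈ Ioo l m := by
  have hivt := intermediate_value_uIcc (a := x) (b := y) hk.continuousOn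
  constructor
  · by_contra! hy
    obtain ⟨t, ht, h⟩ := hivt (mem_uIcc.2 (Or.inr ⟨hy, hx.1.le⟩))
    exact hl t ht h
  · by_contra! hy
    obtain ⟨t, ht, h⟩ := hivt (mem_uIcc.2 (Or.inl ⟨hx.2.le, hy⟩))
    exact hm t ht h

/-- The planar Poincaré–Miranda theorem. -/
theorem poincare_miranda {a b c d : ℝ} (hab : a ≤ b) (hcd : c ≤ d) {P Q : ℝ × ℝ → ℝ}
    (hP : Continuous P) (hQ : Continuous Q)
    (hleft : ∀ y ∈ Icc c d, P (a, y) < 0) (hright : ∀ y ∈ Icc c d, 0 < P (b, y))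
    (hbot : ∀ x ∈ Icc a b, Q (x, c) < 0) (htop : ∀ x ∈ Icc a b, 0 < Q (x, d)) :
    ∃ x ∈ Icc a b, ∃ y ∈ Icc c d, P (x, y) = 0 ∧ Q (x, y) = 0 := by
  by_contra! hne
  set κ : ℝ × ℝ → ℝ × ℝ := fun p => (max a (min b p.1), max c (min d p.2)) with hκ
  have hκc : Continuous κ := by fun_prop
  have hκ1 : ∀ p, (κ p).1 ∈ Icc a b := fun p => ⟨le_max_left _ _, max_le hab (min_le_left _ _)⟩
  have hκ2 : ∀ p, (κ p).2 ∈ Icc c d := fun p => ⟨le_max_left _ _, max_le hcd (min_le_left _ _)⟩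
  have hκid : ∀ x ∈ Icc a b, ∀ y ∈ Icc c d, κ (x, y) = (x, y) := by
    intro x hx y hy
    simp [hκ, hx.1, hx.2, hy.1, hy.2]
  set G : C(ℝ × ℝ, ℂ) := ⟨fun p => (P (κ p) : ℂ) + (Q (κ p) : ℂ) * Complex.I, by fun_prop⟩
    with hG
  have hre : ∀ p, (G p).re = P (κ p) := by intro p; simp [hG]
  have him : ∀ p, (G p).im = Q (κ p) := by intro p; simp [hG]
  have hG0 : ∀ p, G p ∈ ({0}ᶜ : Set ℂ) := by
    intro p hp
    have hp' : G p = 0 := hp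
    have h1 : P (κ p) = 0 := by rw [← hre, hp']; rfl
    have h2 : Q (κ p) = 0 := by rw [← him, hp']; rfl
    exact hne _ (hκ1 p) _ (hκ2 p) h1 h2
  obtain ⟨Λ, ⟨hΛ0, hΛ⟩, -⟩ := Complex.isCoveringMapOn_exp.existsUnique_continuousMap_lifts G
    (a₀ := (b, c)) (e₀ := Complex.log (G (b, c))) (Complex.exp_log (hG0 _)) hG0
  have hexp : ∀ p, Complex.exp (Λ p) = G p := fun p => congrFun hΛ p
  have hcos : ∀ x ∈ Icc a b, ∀ y ∈ Icc c d,
      P (x, y) = Real.exp (Λ (x, y)).re * Real.cos (Λ (x, y)).im := by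
    intro x hx y hy
    rw [← Complex.exp_re, hexp, hre, hκid x hx y hy]
  have hsin : ∀ x ∈ Icc a b, ∀ y ∈ Icc c d,
      Q (x, y) = Real.exp (Λ (x, y)).re * Real.sin (Λ (x, y)).im := by
    intro x hx y hy
    rw [← Complex.exp_im, hexp, him, hκid x hx y hy]
  have haI : a ∈ Icc a b := left_mem_Icc.2 hab
  have hbI : b ∈ Icc a b := right_mem_Icc.2 hab
  have hcI : c ∈ Icc c d := left_mem_Icc.2 hcd
  have hdI : d ∈ Icc c d := right_mem_Icc.2 hcd
  have hpi := Real.pi_pos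
  have hsin0 : ∀ x ∈ Icc a b, ∀ y ∈ Icc c d, Q (x, y) ≠ 0 → ∀ n : ℤ,
      (Λ (x, y)).im ≠ n * Real.pi := by
    intro x hx y hy hQ0 n hn
    apply hQ0
    rw [hsin x hx y hy, hn, Real.sin_int_mul_pi, mul_zero]
  have hcos0 : ∀ x ∈ Icc a b, ∀ y ∈ Icc c d, P (x, y) ≠ 0 → ∀ n : ℤ,
      (Λ (x, y)).im ≠ (2 * n + 1) * Real.pi / 2 := by
    intro x hx y hy hP0 n hn
    apply hP0
    rw [hcos x hx y hy, Real.cos_eq_zero_iff.2 ⟨n, hn⟩, mul_zero]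
  have hstart : (Λ (b, c)).im ∈ Ioo (-(Real.pi / 2)) 0 := by
    rw [hΛ0, Complex.log_im]
    have h1 : 0 < (G (b, c)).re := by rw [hre, hκid b hbI c hcI]; exact hright c hcI
    have h2 : (G (b, c)).im < 0 := by rw [him, hκid b hbI c hcI]; exact hbot b hbI
    refine ⟨?_, Complex.arg_neg_iff.2 h2⟩
    exact (abs_lt.1 (Complex.abs_arg_lt_pi_div_two_iff.2 (Or.inl h1))).1
  have hx_cont : ∀ y, Continuous fun x => (Λ (x, y)).im := by
    intro y; exact Complex.continuous_im.comp (Λ.continuous.comp (by fun_prop))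
  have hy_cont : ∀ x, Continuous fun y => (Λ (x, y)).im := by
    intro x; exact Complex.continuous_im.comp (Λ.continuous.comp (by fun_prop))
  have hbottom : (Λ (a, c)).im ∈ Ioo (-Real.pi) 0 := by
    refine mem_Ioo_of_avoids (x := b) (hx_cont c) ?_ ?_ ⟨by linarith [hstart.1], hstart.2⟩
    all_goals
      intro t ht
      rw [uIcc_of_ge hab] at ht
    · have := hsin0 t ht c hcI (hbot t ht).ne (-1); simpa using this
    · have := hsin0 t ht c hcI (hbot t ht).ne 0; simpa using this
  have hrt : (Λ (b, d)).im ∈ Ioo (-(Real.pi / 2)) (Real.pi / 2) := by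
    refine mem_Ioo_of_avoids (x := c) (hy_cont b) ?_ ?_ ⟨hstart.1, by linarith [hstart.2]⟩
    all_goals
      intro t ht
      rw [uIcc_of_le hcd] at ht
    · have := hcos0 b hbI t ht (hright t ht).ne' (-1)
      intro h; apply this; rw [h]; push_cast; ring
    · have := hcos0 b hbI t ht (hright t ht).ne' 0
      intro h; apply this; rw [h]; push_cast; ring
  have hrt0 : 0 < (Λ (b, d)).im := by
    by_contra! h
    have h1 := htop b hbI
    rw [hsin b hbI d hdI] at h1
    have := Real.sin_nonpos_of_nonpos_of_neg_pi_le h (by linarith [hrt.1])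
    nlinarith [Real.exp_pos (Λ (b, d)).re]
  have htp : (Λ (a, d)).im ∈ Ioo 0 Real.pi := by
    refine mem_Ioo_of_avoids (x := b) (hx_cont d) ?_ ?_ ⟨hrt0, by linarith [hrt.2]⟩
    all_goals
      intro t ht
      rw [uIcc_of_ge hab] at ht
    · have := hsin0 t ht d hdI (htop t ht).ne' 0; simpa using this
    · have := hsin0 t ht d hdI (htop t ht).ne' 1; simpa using this
  have hlt0 : Real.pi / 2 < (Λ (a, d)).im := by
    by_contra! h
    have h1 := hleft d hdI
    rw [hcos a haI d hdI] at h1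
    have := Real.cos_nonneg_of_neg_pi_div_two_le_of_le (by linarith [htp.1]) h
    nlinarith [Real.exp_pos (Λ (a, d)).re]
  have hlt : (Λ (a, c)).im ∈ Ioo (Real.pi / 2) (3 * Real.pi / 2) := by
    refine mem_Ioo_of_avoids (x := d) (hy_cont a) ?_ ?_ ⟨hlt0, by linarith [htp.2]⟩
    all_goals
      intro t ht
      rw [uIcc_of_ge hcd] at ht
    · have := hcos0 a haI t ht (hleft t ht).ne 0
      intro h; apply this; rw [h]; push_cast; ring
    · have := hcos0 a haI t ht (hleft t ht).ne 1
      intro h; apply this; rw [h]; push_cast; ring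
  linarith [hlt.1, hbottom.2]

end

section

open scoped Topology

/-- `h` is measurable in time, continuous in space, and globally dominated by the integrable
function `γ`. -/
structure DominatedCaratheodory (h : ℝ → ℝ → ℝ) (γ : ℝ → ℝ) : Prop where
  cont : ∀ t, Continuous (h t)
  meas : ∀ u, Measurable fun t => h t u
  bound : ∀ t u, |h t u| ≤ γ t
  integrable : Integrable γ

namespace DominatedCaratheodory

variable {h : ℝ → ℝ → ℝ} {γ : ℝ → ℝ}

theorem bound_nonneg (H : DominatedCaratheodory h γ) (t : ℝ) : 0 ≤ γ t :=
  (abs_nonneg _).trans (H.bound t 0)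

theorem measurable_comp (H : DominatedCaratheodory h γ) {u : ℝ → ℝ} (hu : Measurable u) :
    Measurable fun t => h t (u t) := by
  have h1 : Measurable (Function.uncurry fun u t => h t u) :=
    measurable_uncurry_of_continuous_of_measurable H.cont H.meas
  exact h1.comp (hu.prodMk measurable_id)

theorem integrable_comp (H : DominatedCaratheodory h γ) {u : ℝ → ℝ} (hu : Measurable u) :
    Integrable fun t => h t (u t) :=
  H.integrable.mono' (H.measurable_comp hu).aestronglyMeasurable
    (Eventually.of_forall fun t => H.bound t (u t))

theorem intervalIntegrable (H : DominatedCaratheodory h γ) (s : ℝ) {u : ℝ → ℝ}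
    (hu : Measurable u) (a b : ℝ) :
    IntervalIntegrable (fun t => s - h t (u t)) volume a b :=
  intervalIntegrable_const.sub (H.integrable_comp hu).intervalIntegrable

theorem abs_forcing_le (H : DominatedCaratheodory h γ) (s t u : ℝ) :
    |s - h t u| ≤ |s| + γ t :=
  (abs_sub _ _).trans (by gcongr; exact H.bound t u)

theorem intervalIntegrable_forcing_bound (H : DominatedCaratheodory h γ) (s a b : ℝ) :
    IntervalIntegrable (fun t => |s| + γ t) volume a b :=
  intervalIntegrable_const.add H.integrable.intervalIntegrable

end DominatedCaratheodory

/-- Solutions on `[0,T]` of the Liénard system `u' = ψ(z - F(u))`, `z' = s - h(t,u)`, in which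
the right-hand sides are evaluated with delay `δ`, constantly extended to negative times. -/
def DelayOrbit (T : ℝ) (ψ F : ℝ → ℝ) (h : ℝ → ℝ → ℝ) (s δ : ℝ) (u z : ℝ → ℝ) : Prop :=
  Continuous u ∧ Continuous z ∧ ∀ t ∈ Icc (0:ℝ) T,
    u t = u 0 + (∫ τ in (0:ℝ)..t, ψ (z (max (τ - δ) 0) - F (u (max (τ - δ) 0)))) ∧
    z t = z 0 + ∫ τ in (0:ℝ)..t, (s - h τ (u (max (τ - δ) 0)))

/-- Picard iterates of the delayed Liénard system. -/
def delayIter (ψ F : ℝ → ℝ) (h : ℝ → ℝ → ℝ) (s δ : ℝ) : ℕ → ℝ × ℝ → ℝ → ℝ × ℝ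
  | 0, p, _ => p
  | n + 1, p, t =>
    (p.1 + ∫ τ in (0:ℝ)..t, ψ ((delayIter ψ F h s δ n p (max (τ - δ) 0)).2 -
        F (delayIter ψ F h s δ n p (max (τ - δ) 0)).1),
      p.2 + ∫ τ in (0:ℝ)..t, (s - h τ (delayIter ψ F h s δ n p (max (τ - δ) 0)).1))

variable {T : ℝ} {ψ F : ℝ → ℝ} {h : ℝ → ℝ → ℝ} {γ : ℝ → ℝ} {s δ : ℝ}

/-- The primitive of a dominated Carathéodory function along a continuous family of curves is
jointly continuous. -/
theorem DominatedCaratheodory.continuous_primitive (H : DominatedCaratheodory h γ) (s : ℝ)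
    {w : ℝ × ℝ → ℝ → ℝ} (hw : Continuous (Function.uncurry w)) :
    Continuous fun q : (ℝ × ℝ) × ℝ => ∫ τ in (0:ℝ)..q.2, (s - h τ (w q.1 τ)) := by
  rw [continuous_iff_continuousAt]
  rintro ⟨p, t⟩
  have hmeas : ∀ p, Measurable fun τ => h τ (w p τ) := fun p =>
    H.measurable_comp (hw.comp (Continuous.prodMk_right p)).measurable
  refine intervalIntegral.continuousAt_parametric_primitive_of_dominated
    (F := fun p τ => s - h τ (w p τ)) (fun τ => |s| + γ τ) (-(|t| + 1)) (|t| + 1) ?_ ?_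
    (H.intervalIntegrable_forcing_bound s _ _) ?_ ?_ ?_ (by simp)
  · exact fun p => (measurable_const.sub (hmeas p)).aestronglyMeasurable
  · exact Eventually.of_forall fun p => Eventually.of_forall fun τ => H.abs_forcing_le s τ _
  · refine Eventually.of_forall fun τ => Continuous.continuousAt ?_
    have h1 : Continuous fun p => w p τ := hw.comp (Continuous.prodMk_left τ)
    exact continuous_const.sub ((H.cont τ).comp h1)
  · constructor <;> linarith [abs_nonneg t]
  · constructor <;> linarith [neg_abs_le t, le_abs_self t]

theorem continuous_delayIter (hψ : Continuous ψ) (hF : Continuous F)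
    (H : DominatedCaratheodory h γ) (s δ : ℝ) (n : ℕ) :
    Continuous (Function.uncurry (delayIter ψ F h s δ n)) := by
  induction n with
  | zero => exact continuous_fst
  | succ n ih =>
    have hd : Continuous fun q : (ℝ × ℝ) × ℝ => delayIter ψ F h s δ n q.1 (max (q.2 - δ) 0) :=
      ih.comp (by fun_prop : Continuous fun q : (ℝ × ℝ) × ℝ => (q.1, max (q.2 - δ) 0))
    have h1 : Continuous fun q : (ℝ × ℝ) × ℝ => q.1.1 +
        ∫ τ in (0:ℝ)..q.2, ψ ((delayIter ψ F h s δ n q.1 (max (τ - δ) 0)).2 -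
          F (delayIter ψ F h s δ n q.1 (max (τ - δ) 0)).1) := by
      refine (continuous_fst.comp continuous_fst).add
        (intervalIntegral.continuous_parametric_primitive_of_continuous
          (f := fun p τ => ψ ((delayIter ψ F h s δ n p (max (τ - δ) 0)).2 -
            F (delayIter ψ F h s δ n p (max (τ - δ) 0)).1)) ?_)
      exact hψ.comp ((continuous_snd.comp hd).sub (hF.comp (continuous_fst.comp hd)))
    have h2 := (continuous_snd.comp continuous_fst).add
      (H.continuous_primitive s (w := fun p τ => (delayIter ψ F h s δ n p (max (τ - δ) 0)).1)
        (continuous_fst.comp hd))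
    exact h1.prodMk h2

theorem delayIter_zero (n : ℕ) (p : ℝ × ℝ) : delayIter ψ F h s δ n p 0 = p := by
  cases n <;> simp [delayIter]

theorem delayIter_succ_eq (hδ : 0 < δ) (n : ℕ) (p : ℝ × ℝ) :
    ∀ t, 0 ≤ t → t ≤ n * δ →
      delayIter ψ F h s δ (n + 1) p t = delayIter ψ F h s δ n p t := by
  induction n with
  | zero =>
    intro t h0 h1
    have : t = 0 := le_antisymm (by simpa using h1) h0
    subst this
    rw [delayIter_zero, delayIter_zero]
  | succ n ih =>
    intro t h0 h1
    have key : ∀ τ ∈ uIcc 0 t, delayIter ψ F h s δ (n + 1) p (max (τ - δ) 0) =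
        delayIter ψ F h s δ n p (max (τ - δ) 0) := by
      intro τ hτ
      rw [uIcc_of_le h0] at hτ
      refine ih _ (le_max_right _ _) (max_le ?_ (by positivity))
      push_cast at h1
      linarith [hτ.2]
    rw [delayIter, delayIter]
    congr 2
    · refine intervalIntegral.integral_congr fun τ hτ => ?_
      simp only [key τ hτ]
    · refine intervalIntegral.integral_congr fun τ hτ => ?_
      simp only [key τ hτ]

/-- For positive delay the Liénard system has a globally defined continuous flow. -/
theorem exists_delayFlow (hψ : Continuous ψ) (hF : Continuous F)
    (H : DominatedCaratheodory h γ) (T s : ℝ) (hδ : 0 < δ) :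
    ∃ X : ℝ × ℝ → ℝ → ℝ × ℝ, Continuous (Function.uncurry X) ∧ (∀ p, X p 0 = p) ∧
      ∀ p, DelayOrbit T ψ F h s δ (fun t => (X p t).1) (fun t => (X p t).2) := by
  obtain ⟨N, hN⟩ := exists_nat_ge (T / δ)
  have hN' : T ≤ N * δ := by rwa [div_le_iff₀ hδ] at hN
  have hc := continuous_delayIter hψ hF H s δ N
  have hc' : ∀ p, Continuous (delayIter ψ F h s δ N p) := fun p =>
    hc.comp (Continuous.prodMk_right p)
  refine ⟨delayIter ψ F h s δ N, hc, delayIter_zero N, fun p =>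
    ⟨continuous_fst.comp (hc' p), continuous_snd.comp (hc' p), fun t ht => ?_⟩⟩
  have := delayIter_succ_eq (ψ := ψ) (F := F) (h := h) (s := s) hδ N p t ht.1 (ht.2.trans hN')
  simp only [delayIter_zero]
  rw [← this]
  exact ⟨rfl, rfl⟩

end

section

open scoped Topology

variable {T : ℝ} {ψ F : ℝ → ℝ} {h : ℝ → ℝ → ℝ} {γ : ℝ → ℝ} {s δ : ℝ} {u z : ℝ → ℝ}

theorem continuous_delayed (hu : Continuous u) (δ : ℝ) :
    Continuous fun τ : ℝ => u (max (τ - δ) 0) :=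
  hu.comp (by fun_prop)

theorem DelayOrbit.momentum_sub (hx : DelayOrbit T ψ F h s δ u z)
    (H : DominatedCaratheodory h γ) {a b : ℝ} (ha : a ∈ Icc 0 T) (hb : b ∈ Icc 0 T) :
    z b - z a = ∫ τ in a..b, (s - h τ (u (max (τ - δ) 0))) := by
  have hi := H.intervalIntegrable s (continuous_delayed hx.1 δ).measurable
  rw [(hx.2.2 b hb).2, (hx.2.2 a ha).2, ← intervalIntegral.integral_add_adjacent_intervals
    (hi 0 a) (hi a b)]
  ring

theorem DelayOrbit.position_sub (hx : DelayOrbit T ψ F h s δ u z) (hψ : Continuous ψ)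
    (hF : Continuous F) {a b : ℝ} (ha : a ∈ Icc 0 T) (hb : b ∈ Icc 0 T) :
    u b - u a = ∫ τ in a..b, ψ (z (max (τ - δ) 0) - F (u (max (τ - δ) 0))) := by
  have hc : Continuous fun τ : ℝ => ψ (z (max (τ - δ) 0) - F (u (max (τ - δ) 0))) :=
    hψ.comp ((continuous_delayed hx.2.1 δ).sub (hF.comp (continuous_delayed hx.1 δ)))
  have hi := fun a b => hc.intervalIntegrable (μ := volume) a b
  rw [(hx.2.2 b hb).1, (hx.2.2 a ha).1, ← intervalIntegral.integral_add_adjacent_intervals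
    (hi 0 a) (hi a b)]
  ring

theorem DelayOrbit.abs_momentum_sub_le (hx : DelayOrbit T ψ F h s δ u z)
    (H : DominatedCaratheodory h γ) {S : ℝ} (hS : |s| ≤ S) {a b : ℝ} (ha : a ∈ Icc 0 T)
    (hb : b ∈ Icc 0 T) (hab : a ≤ b) :
    |z b - z a| ≤ ∫ τ in a..b, (S + γ τ) := by
  rw [hx.momentum_sub H ha hb]
  rw [← Real.norm_eq_abs]
  refine intervalIntegral.norm_integral_le_of_norm_le hab
    (Eventually.of_forall fun τ _ => ?_)
    (intervalIntegrable_const.add H.integrable.intervalIntegrable)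
  exact (H.abs_forcing_le s τ _).trans (by gcongr)

theorem DominatedCaratheodory.integral_bound_le (H : DominatedCaratheodory h γ) {S : ℝ}
    (hS : 0 ≤ S) {a b : ℝ} (ha : a ∈ Icc 0 T) (hb : b ∈ Icc 0 T) (hab : a ≤ b) :
    ∫ τ in a..b, (S + γ τ) ≤ S * T + ∫ τ, γ τ := by
  rw [intervalIntegral.integral_add intervalIntegrable_const
    H.integrable.intervalIntegrable, intervalIntegral.integral_const, smul_eq_mul,
    intervalIntegral.integral_of_le hab, mul_comm]
  have : b - a ≤ T := by linarith [ha.1, hb.2]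
  gcongr
  · exact Eventually.of_forall H.bound_nonneg
  · exact H.integrable
  · exact Measure.restrict_le_self

theorem DelayOrbit.abs_momentum_le (hx : DelayOrbit T ψ F h s δ u z)
    (H : DominatedCaratheodory h γ) {S : ℝ} (hS : |s| ≤ S) {t : ℝ} (ht : t ∈ Icc 0 T) :
    |z t - z 0| ≤ S * T + ∫ τ, γ τ :=
  have h0 : (0:ℝ) ∈ Icc 0 T := ⟨le_rfl, ht.1.trans ht.2⟩
  (hx.abs_momentum_sub_le H hS h0 ht ht.1).trans
    (H.integral_bound_le ((abs_nonneg s).trans hS) h0 ht ht.1)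

theorem max_sub_mem_Icc (hδ : 0 ≤ δ) {t : ℝ} (ht : t ∈ Icc 0 T) :
    max (t - δ) 0 ∈ Icc 0 T :=
  ⟨le_max_right _ _, max_le (by linarith [ht.2]) (ht.1.trans ht.2)⟩

/-- The positions of an orbit whose velocity argument lies in `[-Y, Y]` are Lipschitz. -/
theorem DelayOrbit.abs_position_sub_le (hx : DelayOrbit T ψ F h s δ u z) (hψ : Continuous ψ)
    (hF : Continuous F) (hδ : 0 ≤ δ) {Y B : ℝ} (hB : ∀ y ∈ Icc (-Y) Y, |ψ y| ≤ B)
    (hY : ∀ t ∈ Icc 0 T, |z t - F (u t)| ≤ Y) {a b : ℝ} (ha : a ∈ Icc 0 T)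
    (hb : b ∈ Icc 0 T) (hab : a ≤ b) :
    |u b - u a| ≤ B * (b - a) := by
  rw [hx.position_sub hψ hF ha hb]
  have := intervalIntegral.norm_integral_le_of_norm_le_const (a := a) (b := b) (C := B)
    (f := fun τ => ψ (z (max (τ - δ) 0) - F (u (max (τ - δ) 0)))) ?_
  · rwa [abs_of_nonneg (by linarith : 0 ≤ b - a)] at this
  · intro τ hτ
    rw [uIoc_of_le hab] at hτ
    have hτ' : τ ∈ Icc 0 T := ⟨ha.1.trans hτ.1.le, hτ.2.trans hb.2⟩
    exact hB _ (abs_le.1 (hY _ (max_sub_mem_Icc hδ hτ')))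

/-- A sequence of functions on `[0,T]` with values in a compact set and a common modulus of
continuity has a uniformly convergent subsequence. -/
theorem exists_subseq_tendstoUniformlyOn (hT : 0 ≤ T) {x : ℕ → ℝ → ℝ × ℝ}
    (hx : ∀ n, Continuous (x n)) {K : Set (ℝ × ℝ)} (hK : IsCompact K)
    (hxK : ∀ n, ∀ t ∈ Icc 0 T, x n t ∈ K) {Ω : ℝ → ℝ} (hΩ : ContinuousOn Ω (Icc 0 T))
    (hmod : ∀ n, ∀ a ∈ Icc 0 T, ∀ b ∈ Icc 0 T, dist (x n a) (x n b) ≤ dist (Ω a) (Ω b)) :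
    ∃ (y : ℝ → ℝ × ℝ) (k : ℕ → ℕ), Continuous y ∧ StrictMono k ∧
      TendstoUniformlyOn (fun n => x (k n)) y atTop (Icc 0 T) := by
  set X : ℕ → BoundedContinuousFunction (Icc (0:ℝ) T) (ℝ × ℝ) := fun n =>
    BoundedContinuousFunction.mkOfCompact
      ⟨fun t => x n t, (hx n).comp continuous_subtype_val⟩ with hX
  have hcomp : IsCompact (closure (range X)) := by
    refine BoundedContinuousFunction.arzela_ascoli K hK _ ?_ ?_
    · rintro _ t ⟨n, rfl⟩
      exact hxK n t t.2
    · intro t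
      rw [Metric.equicontinuousAt_iff]
      intro ε hε
      have hc : Continuous fun t : Icc (0:ℝ) T => Ω t :=
        continuousOn_iff_continuous_domRestrict.1 hΩ
      obtain ⟨η, hη, hη'⟩ := Metric.continuousAt_iff.1 (hc.continuousAt (x := t)) ε hε
      refine ⟨η, hη, ?_⟩
      rintro r hr ⟨_, n, rfl⟩
      calc dist (x n t) (x n r) ≤ dist (Ω t) (Ω r) := hmod n t t.2 r r.2
        _ = dist (Ω r) (Ω t) := dist_comm _ _
        _ < ε := hη' hr
  obtain ⟨Y, -, k, hk, hlim⟩ := hcomp.tendsto_subseq fun n => subset_closure (mem_range_self n)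
  refine ⟨fun t => Y (projIcc 0 T hT t), k, Y.continuous.comp continuous_projIcc, hk, ?_⟩
  rw [BoundedContinuousFunction.tendsto_iff_tendstoUniformly] at hlim
  rw [Metric.tendstoUniformlyOn_iff]
  intro ε hε
  filter_upwards [Metric.tendstoUniformly_iff.1 hlim ε hε] with n hn t ht
  simpa [hX, projIcc_of_mem hT ht] using hn ⟨t, ht⟩

/-- Delayed orbits with bounded initial data subconverge, as the delay tends to zero, to an
orbit without delay. -/
theorem exists_limit_orbit (hT : 0 ≤ T) (hψ : Continuous ψ) (hF : Continuous F) {A : ℝ}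
    (hA : ∀ x, |F x| ≤ A) (H : DominatedCaratheodory h γ) {u z : ℕ → ℝ → ℝ} {σ δ : ℕ → ℝ}
    (hx : ∀ n, DelayOrbit T ψ F h (σ n) (δ n) (u n) (z n)) (hδ0 : ∀ n, 0 ≤ δ n)
    (hδ : Tendsto δ atTop (𝓝 0)) (hσ : Tendsto σ atTop (𝓝 s)) {R : ℝ}
    (hu0 : ∀ n, |u n 0| ≤ R) (hz0 : ∀ n, |z n 0| ≤ R) :
    ∃ (v w : ℝ → ℝ) (k : ℕ → ℕ), StrictMono k ∧ DelayOrbit T ψ F h s 0 v w ∧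
      TendstoUniformlyOn (fun n => u (k n)) v atTop (Icc 0 T) ∧
      TendstoUniformlyOn (fun n => z (k n)) w atTop (Icc 0 T) := by
  obtain ⟨S, hS⟩ : ∃ S, ∀ n, |σ n| ≤ S := by
    obtain ⟨S, hS⟩ := (Metric.isBounded_range_of_tendsto σ hσ).exists_norm_le
    exact ⟨S, fun n => hS _ (mem_range_self n)⟩
  have hS0 : 0 ≤ S := (abs_nonneg _).trans (hS 0)
  have h0 : (0:ℝ) ∈ Icc 0 T := ⟨le_rfl, hT⟩
  set Z := R + (S * T + ∫ τ, γ τ) with hZ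
  have hzZ : ∀ n, ∀ t ∈ Icc 0 T, |z n t| ≤ Z := by
    intro n t ht
    have h1 := (hx n).abs_momentum_le H (hS n) ht
    have h2 := abs_add_le (z n t - z n 0) (z n 0)
    rw [sub_add_cancel] at h2
    linarith [hz0 n]
  set Y := Z + A with hYdef
  obtain ⟨B, hB⟩ := isCompact_Icc.exists_bound_of_continuousOn (s := Icc (-Y) Y)
    hψ.continuousOn
  have hY : ∀ n, ∀ t ∈ Icc 0 T, |z n t - F (u n t)| ≤ Y := fun n t ht =>
    (abs_sub _ _).trans (add_le_add (hzZ n t ht) (hA _))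
  have hB0 : 0 ≤ B := (norm_nonneg _).trans (hB _ (abs_le.1 (hY 0 0 h0)))
  have hlip : ∀ n, ∀ a ∈ Icc 0 T, ∀ b ∈ Icc 0 T, a ≤ b → |u n b - u n a| ≤ B * (b - a) :=
    fun n a ha b hb hab => (hx n).abs_position_sub_le hψ hF (hδ0 n) hB (hY n) ha hb hab
  have hSγ : ∀ a b, IntervalIntegrable (fun τ => S + γ τ) volume a b := fun a b =>
    intervalIntegrable_const.add H.integrable.intervalIntegrable
  set Ω : ℝ → ℝ := fun t => B * t + ∫ τ in (0:ℝ)..t, (S + γ τ) with hΩ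
  have hΩc : Continuous Ω :=
    (continuous_const.mul continuous_id).add
      (intervalIntegral.continuous_primitive hSγ 0)
  have hΩsub : ∀ a b, Ω b - Ω a = B * (b - a) + ∫ τ in a..b, (S + γ τ) := by
    intro a b
    simp only [hΩ]
    rw [← intervalIntegral.integral_add_adjacent_intervals (hSγ 0 a) (hSγ a b)]
    ring
  have hmod_le : ∀ n, ∀ a ∈ Icc 0 T, ∀ b ∈ Icc 0 T, a ≤ b →
      dist ((u n a, z n a) : ℝ × ℝ) (u n b, z n b) ≤ dist (Ω a) (Ω b) := by
    intro n a ha b hb hab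
    have h1 : 0 ≤ ∫ τ in a..b, (S + γ τ) := intervalIntegral.integral_nonneg hab
      fun τ _ => add_nonneg hS0 (H.bound_nonneg τ)
    have h2 : 0 ≤ B * (b - a) := mul_nonneg hB0 (by linarith)
    rw [dist_comm (Ω a), Real.dist_eq, hΩsub, abs_of_nonneg (by positivity), dist_comm,
      Prod.dist_eq, Real.dist_eq, Real.dist_eq]
    refine max_le ?_ ?_
    · exact (hlip n a ha b hb hab).trans (by linarith)
    · exact ((hx n).abs_momentum_sub_le H (hS n) ha hb hab).trans (by linarith)
  have hmod : ∀ n, ∀ a ∈ Icc 0 T, ∀ b ∈ Icc 0 T,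
      dist ((u n a, z n a) : ℝ × ℝ) (u n b, z n b) ≤ dist (Ω a) (Ω b) := by
    intro n a ha b hb
    rcases le_total a b with hab | hab
    · exact hmod_le n a ha b hb hab
    · rw [dist_comm, dist_comm (Ω a)]
      exact hmod_le n b hb a ha hab
  have huR : ∀ n, ∀ t ∈ Icc 0 T, |u n t| ≤ R + B * T := by
    intro n t ht
    have h1 := hlip n 0 h0 t ht ht.1
    have h2 := abs_add_le (u n t - u n 0) (u n 0)
    rw [sub_add_cancel] at h2
    nlinarith [hu0 n, ht.2]
  obtain ⟨y, k, hy, hk, hlim⟩ := exists_subseq_tendstoUniformlyOn hT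
    (x := fun n t => (u n t, z n t)) (fun n => (hx n).1.prodMk (hx n).2.1)
    (K := Icc (-(R + B * T)) (R + B * T) ×ˢ Icc (-Z) Z) (isCompact_Icc.prod isCompact_Icc)
    (fun n t ht => ⟨abs_le.1 (huR n t ht), abs_le.1 (hzZ n t ht)⟩) hΩc.continuousOn hmod
  have hlimu : TendstoUniformlyOn (fun n => u (k n)) (fun t => (y t).1) atTop (Icc 0 T) := by
    rw [Metric.tendstoUniformlyOn_iff] at hlim ⊢
    intro ε hε
    filter_upwards [hlim ε hε] with n hn t ht
    exact (le_max_left _ _).trans_lt (hn t ht)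
  have hlimz : TendstoUniformlyOn (fun n => z (k n)) (fun t => (y t).2) atTop (Icc 0 T) := by
    rw [Metric.tendstoUniformlyOn_iff] at hlim ⊢
    intro ε hε
    filter_upwards [hlim ε hε] with n hn t ht
    exact (le_max_right _ _).trans_lt (hn t ht)
  have hyu : Continuous fun t => (y t).1 := continuous_fst.comp hy
  have hyz : Continuous fun t => (y t).2 := continuous_snd.comp hy
  have hδk : Tendsto (fun n => δ (k n)) atTop (𝓝 0) := hδ.comp hk.tendsto_atTop
  have htime : ∀ τ ∈ Icc 0 T, Tendsto (fun n => max (τ - δ (k n)) 0) atTop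
      (𝓝[Icc 0 T] (max (τ - 0) 0)) := by
    intro τ hτ
    refine tendsto_nhdsWithin_iff.2 ⟨(tendsto_const_nhds.sub hδk).max tendsto_const_nhds, ?_⟩
    exact Eventually.of_forall fun n => max_sub_mem_Icc (hδ0 _) hτ
  have hptu : ∀ τ ∈ Icc 0 T, Tendsto (fun n => u (k n) (max (τ - δ (k n)) 0)) atTop
      (𝓝 (y (max (τ - 0) 0)).1) := fun τ hτ =>
    hlimu.tendsto_comp hyu.continuousWithinAt (htime τ hτ)
  have hptz : ∀ τ ∈ Icc 0 T, Tendsto (fun n => z (k n) (max (τ - δ (k n)) 0)) atTop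
      (𝓝 (y (max (τ - 0) 0)).2) := fun τ hτ =>
    hlimz.tendsto_comp hyz.continuousWithinAt (htime τ hτ)
  refine ⟨fun t => (y t).1, fun t => (y t).2, k, hk, ⟨hyu, hyz, fun t ht => ⟨?_, ?_⟩⟩,
    hlimu, hlimz⟩
  · have h1 := hlimu.tendsto_at ht
    have h2 := hlimu.tendsto_at h0
    refine tendsto_nhds_unique h1 ?_
    simp only [fun n => ((hx (k n)).2.2 t ht).1]
    refine h2.add (intervalIntegral.tendsto_integral_filter_of_dominated_convergence
      (fun _ => B) ?_ ?_ intervalIntegrable_const ?_)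
    · refine Eventually.of_forall fun n => Continuous.aestronglyMeasurable ?_
      exact hψ.comp ((continuous_delayed (hx _).2.1 _).sub
        (hF.comp (continuous_delayed (hx _).1 _)))
    · refine Eventually.of_forall fun n => Eventually.of_forall fun τ hτ => ?_
      rw [uIoc_of_le ht.1] at hτ
      exact hB _ (abs_le.1 (hY _ _ (max_sub_mem_Icc (hδ0 _) ⟨hτ.1.le, hτ.2.trans ht.2⟩)))
    · refine Eventually.of_forall fun τ hτ => ?_
      rw [uIoc_of_le ht.1] at hτ
      have hτ' : τ ∈ Icc 0 T := ⟨hτ.1.le, hτ.2.trans ht.2⟩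
      exact (hψ.tendsto _).comp ((hptz τ hτ').sub ((hF.tendsto _).comp (hptu τ hτ')))
  · have h1 := hlimz.tendsto_at ht
    have h2 := hlimz.tendsto_at h0
    refine tendsto_nhds_unique h1 ?_
    simp only [fun n => ((hx (k n)).2.2 t ht).2]
    refine h2.add (intervalIntegral.tendsto_integral_filter_of_dominated_convergence
      (fun τ => S + γ τ) ?_ ?_ (hSγ 0 t) ?_)
    · refine Eventually.of_forall fun n => Measurable.aestronglyMeasurable ?_
      exact measurable_const.sub (H.measurable_comp (continuous_delayed (hx _).1 _).measurable)
    · refine Eventually.of_forall fun n => Eventually.of_forall fun τ _ => ?_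
      exact (H.abs_forcing_le _ τ _).trans (by gcongr; exact hS _)
    · refine Eventually.of_forall fun τ hτ => ?_
      rw [uIoc_of_le ht.1] at hτ
      have hτ' : τ ∈ Icc 0 T := ⟨hτ.1.le, hτ.2.trans ht.2⟩
      exact (hσ.comp hk.tendsto_atTop).sub (((H.cont τ).tendsto _).comp (hptu τ hτ'))

end

section

open scoped Topology

variable {T : ℝ} {φ ψ F : ℝ → ℝ} {h : ℝ → ℝ → ℝ} {γ : ℝ → ℝ} {s δ : ℝ} {u z β β' : ℝ → ℝ}

/-- `β` is a `C¹` periodic upper solution of `(φ(u'))' + (F(u))' + h(t,u) = s`, in integrated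
form. -/
def IsUpperSolution (T : ℝ) (φ F : ℝ → ℝ) (h : ℝ → ℝ → ℝ) (s : ℝ) (β β' : ℝ → ℝ) : Prop :=
  Continuous β ∧ IsC1Periodic T β β' ∧ ∀ a ∈ Icc 0 T, ∀ b ∈ Icc 0 T, a ≤ b →
    (φ (β' b) + F (β b)) - (φ (β' a) + F (β a)) ≤ ∫ τ in a..b, (s - h τ (β τ))

theorem DelayOrbit.integral_undelayed (hx : DelayOrbit T ψ F h s 0 u z)
    (H : DominatedCaratheodory h γ) {a b : ℝ} (ha : a ∈ Icc 0 T) (hb : b ∈ Icc 0 T) :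
    z b - z a = ∫ τ in a..b, (s - h τ (u τ)) := by
  rw [hx.momentum_sub H ha hb]
  refine intervalIntegral.integral_congr fun τ hτ => ?_
  have : 0 ≤ τ := (le_min ha.1 hb.1).trans hτ.1
  simp [this]

theorem DelayOrbit.hasDerivWithinAt (hx : DelayOrbit T ψ F h s 0 u z) (hψ : Continuous ψ)
    (hF : Continuous F) {t : ℝ} (ht : t ∈ Icc 0 T) :
    HasDerivWithinAt u (ψ (z t - F (u t))) (Icc 0 T) t := by
  have hc : Continuous fun τ : ℝ => ψ (z (max (τ - 0) 0) - F (u (max (τ - 0) 0))) :=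
    hψ.comp ((continuous_delayed hx.2.1 0).sub (hF.comp (continuous_delayed hx.1 0)))
  have hd : HasDerivAt
      (fun t => u 0 + ∫ τ in (0:ℝ)..t, ψ (z (max (τ - 0) 0) - F (u (max (τ - 0) 0))))
      (ψ (z t - F (u t))) t := by
    have := (intervalIntegral.integral_hasDerivAt_right (hc.intervalIntegrable 0 t)
      (hc.stronglyMeasurableAtFilter _ _) hc.continuousAt).const_add (u 0)
    simpa [ht.1] using this
  exact hd.hasDerivWithinAt.congr (fun τ hτ => (hx.2.2 τ hτ).1) (hx.2.2 t ht).1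

/-- An orbit lying below a strict upper solution cannot touch it tangentially. -/
theorem DelayOrbit.not_tangent (hφ : StrictMono φ) (hψ : Continuous ψ)
    (hφψ : ∀ y, φ (ψ y) = y) {L : ℝ} (hL : 0 ≤ L) (hF : Continuous F)
    (hFL : ∀ x y, |F x - F y| ≤ L * |x - y|) (H : DominatedCaratheodory h γ)
    (hA0 : CondA0 T h) {s' : ℝ} (hs : s' < s) (hβ : IsUpperSolution T φ F h s' β β')
    (hx : DelayOrbit T ψ F h s 0 u z) (hle : ∀ t ∈ Icc 0 T, u t ≤ β t) {t₀ : ℝ}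
    (ht₀ : t₀ ∈ Ico 0 T) (htouch : u t₀ = β t₀) (htan : ψ (z t₀ - F (u t₀)) = β' t₀) :
    False := by
  obtain ⟨hβc, hβC1, hβup⟩ := hβ
  have ht₀' : t₀ ∈ Icc 0 T := Ico_subset_Icc_self ht₀
  set k := (s - s') / 2 with hk
  have hk0 : 0 < k := by linarith
  obtain ⟨δ, hδ, hδ'⟩ := hA0 t₀ ht₀' (β t₀) (k / 2) (by linarith)
  obtain ⟨η₁, hη₁, hu₁⟩ := Metric.continuousAt_iff.1 (hx.1.continuousAt (x := t₀)) δ hδ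
  obtain ⟨η₂, hη₂, hβ₂⟩ := Metric.continuousAt_iff.1 (hβc.continuousAt (x := t₀)) δ hδ
  have hdw : HasDerivWithinAt (fun t => β t - u t) 0 (Icc 0 T) t₀ := by
    have := (hβC1.1 t₀ ht₀').sub (hx.hasDerivWithinAt hψ hF ht₀')
    rwa [htan, sub_self] at this
  have hslope : ∀ᶠ t in 𝓝[Icc 0 T] t₀, β t - u t ≤ k / (2 * (L + 1)) * |t - t₀| := by
    have hlo := hasDerivWithinAt_iff_isLittleO.1 hdw
    filter_upwards [hlo.def (show 0 < k / (2 * (L + 1)) by positivity)] with t ht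
    simp only [htouch, sub_self, smul_zero, sub_zero, Real.norm_eq_abs] at ht
    exact (le_abs_self _).trans ht
  obtain ⟨η₃, hη₃, hw₃⟩ := Metric.mem_nhdsWithin_iff.1 hslope
  obtain ⟨t₁, ht₁, hlt⟩ : ∃ t₁, t₀ < t₁ ∧ t₁ ≤ T ∧ t₁ - t₀ < δ ∧ t₁ - t₀ < η₁ ∧
      t₁ - t₀ < η₂ ∧ t₁ - t₀ < η₃ := by
    set m := min (T - t₀) (min δ (min η₁ (min η₂ η₃))) with hm
    have hm0 : 0 < m := by
      refine lt_min (by linarith [ht₀.2]) (lt_min hδ (lt_min hη₁ (lt_min hη₂ hη₃)))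
    have e1 : m ≤ T - t₀ := min_le_left _ _
    have e2 : m ≤ δ := (min_le_right _ _).trans (min_le_left _ _)
    have e3 : m ≤ η₁ := ((min_le_right _ _).trans (min_le_right _ _)).trans (min_le_left _ _)
    have e4 : m ≤ η₂ := (((min_le_right _ _).trans (min_le_right _ _)).trans
      (min_le_right _ _)).trans (min_le_left _ _)
    have e5 : m ≤ η₃ := (((min_le_right _ _).trans (min_le_right _ _)).trans
      (min_le_right _ _)).trans (min_le_right _ _)
    exact ⟨t₀ + m / 2, by linarith, by linarith, by linarith, by linarith, by linarith,
      by linarith⟩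
  obtain ⟨htT, hlδ, hlη₁, hlη₂, hlη₃⟩ := hlt
  have hsub : Icc t₀ t₁ ⊆ Icc 0 T := Icc_subset_Icc ht₀.1 htT
  have hmom : ∀ t ∈ Icc t₀ t₁, φ (β' t) + F (β t) + k * (t - t₀) ≤ z t := by
    intro t ht
    have htI := hsub ht
    have h1 := hβup t₀ ht₀' t htI ht.1
    have h2 := hx.integral_undelayed H ht₀' htI
    have h3 : z t₀ = φ (β' t₀) + F (β t₀) := by rw [← htan, hφψ, htouch]; ring
    have hi1 := H.intervalIntegrable s' hβc.measurable t₀ t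
    have hi2 := H.intervalIntegrable s hx.1.measurable t₀ t
    have h4 : (∫ τ in t₀..t, (s' - h τ (β τ))) + k * (t - t₀) ≤
        ∫ τ in t₀..t, (s - h τ (u τ)) := by
      have : k * (t - t₀) = ∫ _ in t₀..t, k := by
        rw [intervalIntegral.integral_const, smul_eq_mul, mul_comm]
      rw [this, ← intervalIntegral.integral_add hi1 intervalIntegrable_const]
      refine intervalIntegral.integral_mono_ae_restrict ht.1
        (hi1.add intervalIntegrable_const) hi2 ?_
      have hae : ∀ᵐ τ ∂(volume.restrict (Icc t₀ t)), |τ - t₀| < δ → ∀ y : ℝ,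
          |y - β t₀| < δ → |h τ y - h τ (β t₀)| < k / 2 :=
        ae_restrict_of_ae_restrict_of_subset (Icc_subset_Icc ht₀.1 htI.2) hδ'
      filter_upwards [hae, ae_restrict_mem measurableSet_Icc] with τ hτ hτt
      have hτ0 : |τ - t₀| = τ - t₀ := abs_of_nonneg (by linarith [hτt.1])
      have hτ1 : τ - t₀ ≤ t₁ - t₀ := by linarith [hτt.2, ht.2]
      have e1 := hτ (by rw [hτ0]; linarith) (u τ) (by
        have := hu₁ (x := τ) (by rw [Real.dist_eq, hτ0]; linarith)
        rwa [Real.dist_eq, htouch] at this)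
      have e2 := hτ (by rw [hτ0]; linarith) (β τ) (by
        have := hβ₂ (x := τ) (by rw [Real.dist_eq, hτ0]; linarith)
        rwa [Real.dist_eq] at this)
      rw [abs_lt] at e1 e2
      linarith [e1.2, e2.1]
    linarith
  have hvel : ∀ t ∈ Ioo t₀ t₁, β' t < ψ (z t - F (u t)) := by
    intro t ht
    have htt : t ∈ Icc t₀ t₁ := Ioo_subset_Icc_self ht
    have htI := hsub htt
    refine hφ.lt_iff_lt.1 ?_
    rw [hφψ]
    have h1 := hmom t htt
    have h2 : β t - u t ≤ k / (2 * (L + 1)) * (t - t₀) := by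
      have habs : |t - t₀| = t - t₀ := abs_of_nonneg (by linarith [ht.1])
      have : β t - u t ≤ k / (2 * (L + 1)) * |t - t₀| :=
        hw₃ ⟨by rw [Metric.mem_ball, Real.dist_eq, habs]; linarith [ht.2], htI⟩
      rwa [habs] at this
    have h3 := (abs_le.1 (hFL (u t) (β t))).2
    rw [abs_sub_comm, abs_of_nonneg (by linarith [hle t htI])] at h3
    have h4 : L * (β t - u t) ≤ k / 2 * (t - t₀) := by
      calc L * (β t - u t) ≤ L * (k / (2 * (L + 1)) * (t - t₀)) := by gcongr
        _ = L / (L + 1) * (k / 2 * (t - t₀)) := by field_simp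
        _ ≤ 1 * (k / 2 * (t - t₀)) := by
          have : L / (L + 1) ≤ 1 := by rw [div_le_one (by linarith)]; linarith
          have : 0 ≤ t - t₀ := by linarith [ht.1]
          gcongr
        _ = _ := one_mul _
    nlinarith [ht.1]
  have hanti : StrictAntiOn (fun t => β t - u t) (Icc t₀ t₁) := by
    refine strictAntiOn_of_deriv_neg (convex_Icc _ _) (hβc.sub hx.1).continuousOn ?_
    intro t ht
    rw [interior_Icc] at ht
    have htI : t ∈ Icc 0 T := hsub (Ioo_subset_Icc_self ht)
    have hnhds : Icc 0 T ∈ 𝓝 t := Icc_mem_nhds (by linarith [ht.1, ht₀.1]) (by linarith [ht.2])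
    have hd := ((hβC1.1 t htI).hasDerivAt hnhds).sub
      ((hx.hasDerivWithinAt hψ hF htI).hasDerivAt hnhds)
    have : deriv (fun t => β t - u t) t = β' t - ψ (z t - F (u t)) := hd.deriv
    rw [this]
    linarith [hvel t ht]
  have := hanti (left_mem_Icc.2 ht₁.le) (right_mem_Icc.2 ht₁.le) ht₁
  simp only [htouch, sub_self] at this
  linarith [hle t₁ ⟨ht₀.1.trans ht₁.le, htT⟩]

/-- An orbit with `u(0) = u(T)` and nonnegative momentum defect, lying below a strict upper
solution, does not touch it. -/
theorem DelayOrbit.lt_upperSolution (hT : 0 < T) (hφ : StrictMono φ) (hψ : Continuous ψ)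
    (hφψ : ∀ y, φ (ψ y) = y) {L : ℝ} (hL : 0 ≤ L) (hF : Continuous F)
    (hFL : ∀ x y, |F x - F y| ≤ L * |x - y|) (H : DominatedCaratheodory h γ)
    (hA0 : CondA0 T h) {s' : ℝ} (hs : s' < s) (hβ : IsUpperSolution T φ F h s' β β')
    (hx : DelayOrbit T ψ F h s 0 u z) (hper : u 0 = u T) (hdef : z T ≤ z 0)
    (hle : ∀ t ∈ Icc 0 T, u t ≤ β t) {t₀ : ℝ} (ht₀ : t₀ ∈ Icc 0 T) : u t₀ < β t₀ := by
  refine lt_of_le_of_ne (hle t₀ ht₀) fun htouch => ?_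
  have hno := fun t ht => DelayOrbit.not_tangent (t₀ := t) hφ hψ hφψ hL hF hFL H hA0 hs hβ hx
    hle ht
  have h0 : (0:ℝ) ∈ Icc 0 T := ⟨le_rfl, hT.le⟩
  have hTT : T ∈ Icc 0 T := ⟨hT.le, le_rfl⟩
  have hdw : ∀ t ∈ Icc 0 T,
      HasDerivWithinAt (fun t => β t - u t) (β' t - ψ (z t - F (u t))) (Icc 0 T) t :=
    fun t ht => (hβ.2.1.1 t ht).sub (hx.hasDerivWithinAt hψ hF ht)
  have hdir : ∀ t ∈ Icc 0 T, u t = β t → ∀ r ∈ Icc 0 T,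
      0 ≤ (r - t) * (β' t - ψ (z t - F (u t))) := by
    intro t ht h r hr
    have hmin : IsLocalMinOn (fun t => β t - u t) (Icc 0 T) t := by
      filter_upwards [self_mem_nhdsWithin] with r hr
      linarith [hle r hr]
    have := hmin.hasFDerivWithinAt_nonneg (hdw t ht).hasFDerivWithinAt
      (sub_mem_posTangentConeAt_of_segment_subset ((convex_Icc 0 T).segment_subset ht hr))
    simpa using this
  have hright : ∀ t ∈ Ico 0 T, u t = β t → ψ (z t - F (u t)) ≤ β' t := by
    intro t ht h
    have := hdir t (Ico_subset_Icc_self ht) h T hTT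
    have := nonneg_of_mul_nonneg_right this (by linarith [ht.2])
    linarith
  have hleft : ∀ t ∈ Ioc 0 T, u t = β t → β' t ≤ ψ (z t - F (u t)) := by
    intro t ht h
    have := hdir t (Ioc_subset_Icc_self ht) h 0 h0
    nlinarith [ht.1]
  by_cases hint : t₀ ∈ Ioo 0 T
  · exact hno t₀ ⟨hint.1.le, hint.2⟩ htouch (le_antisymm
      (hright t₀ ⟨hint.1.le, hint.2⟩ htouch) (hleft t₀ ⟨hint.1, hint.2.le⟩ htouch))
  · have hends : u 0 = β 0 ∧ u T = β T := by
      have hβper := hβ.2.1.2.2.1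
      rcases eq_or_lt_of_le ht₀.1 with h | h
      · subst h; exact ⟨htouch, by rw [← hper, htouch, hβper]⟩
      · have : t₀ = T := le_antisymm ht₀.2 (by by_contra! h'; exact hint ⟨h, h'⟩)
        subst this; exact ⟨by rw [hper, htouch, hβper], htouch⟩
    have h1 := hright 0 ⟨le_rfl, hT⟩ hends.1
    have h2 := hleft T ⟨hT, le_rfl⟩ hends.2
    have hψm : Monotone ψ := fun a b hab => by
      rw [← hφ.le_iff_le, hφψ, hφψ]; exact hab
    have h3 : ψ (z T - F (u T)) ≤ ψ (z 0 - F (u 0)) := hψm (by rw [hper]; linarith)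
    have hβ'per := hβ.2.1.2.2.2
    exact hno 0 ⟨le_rfl, hT⟩ hends.1 (le_antisymm h1 (by linarith))

end

section

open scoped Topology

variable {T : ℝ} {φ ψ F : ℝ → ℝ} {h : ℝ → ℝ → ℝ} {γ : ℝ → ℝ} {s δ : ℝ} {u v z β β' : ℝ → ℝ}

/-- The largest value of `u - β` on `[0,T]`. -/
def gap (T : ℝ) (β u : ℝ → ℝ) : ℝ := sSup ((fun t => u t - β t) '' Icc 0 T)

theorem exists_gap_eq (hT : 0 ≤ T) (hβ : Continuous β) (hu : Continuous u) :
    ∃ t ∈ Icc 0 T, gap T β u = u t - β t :=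
  isCompact_Icc.exists_sSup_image_eq (nonempty_Icc.2 hT) (hu.sub hβ).continuousOn

theorem le_gap (hβ : Continuous β) (hu : Continuous u) {t : ℝ} (ht : t ∈ Icc 0 T) :
    u t - β t ≤ gap T β u :=
  le_csSup (isCompact_Icc.bddAbove_image (hu.sub hβ).continuousOn) (mem_image_of_mem _ ht)

theorem abs_gap_sub_gap_le (hT : 0 ≤ T) (hβ : Continuous β) (hu : Continuous u)
    (hv : Continuous v) {ε : ℝ} (h : ∀ t ∈ Icc 0 T, |u t - v t| ≤ ε) :
    |gap T β u - gap T β v| ≤ ε := by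
  obtain ⟨t, ht, h1⟩ := exists_gap_eq hT hβ hu
  obtain ⟨r, hr, h2⟩ := exists_gap_eq hT hβ hv
  have h3 := le_gap (T := T) hβ hu hr
  have h4 := le_gap (T := T) hβ hv ht
  have h5 := abs_le.1 (h t ht)
  have h6 := abs_le.1 (h r hr)
  rw [abs_le]
  constructor <;> linarith

theorem tendsto_gap (hT : 0 ≤ T) (hβ : Continuous β) {u : ℕ → ℝ → ℝ} (hu : ∀ n, Continuous (u n))
    (hv : Continuous v) (h : TendstoUniformlyOn u v atTop (Icc 0 T)) :
    Tendsto (fun n => gap T β (u n)) atTop (𝓝 (gap T β v)) := by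
  rw [Metric.tendsto_nhds]
  intro ε hε
  filter_upwards [Metric.tendstoUniformlyOn_iff.1 h (ε / 2) (half_pos hε)] with n hn
  rw [Real.dist_eq]
  refine (abs_gap_sub_gap_le hT hβ (hu n) hv fun t ht => ?_).trans_lt (half_lt_self hε)
  have := hn t ht
  rw [dist_comm, Real.dist_eq] at this
  exact this.le

/-- An orbit staying where `h` no longer depends on `u` has a positive momentum defect as soon as
the mean of `h` there exceeds `s`. -/
theorem DelayOrbit.defect_pos (hx : DelayOrbit T ψ F h s δ u z) (hT : 0 ≤ T) (hδ : 0 ≤ δ)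
    (H : DominatedCaratheodory h γ) {m : ℝ} (hm : ∀ t ∈ Icc 0 T, ∀ τ, h τ (u t) = h τ m)
    (hs : s * T < ∫ t in (0:ℝ)..T, h t m) : 0 < z 0 - z T := by
  have h1 := hx.momentum_sub H ⟨le_rfl, hT⟩ ⟨hT, le_rfl⟩
  have h2 : ∫ τ in (0:ℝ)..T, (s - h τ (u (max (τ - δ) 0))) = ∫ τ in (0:ℝ)..T, (s - h τ m) := by
    refine intervalIntegral.integral_congr fun τ hτ => ?_
    rw [uIcc_of_le hT] at hτ
    simp only [hm _ (max_sub_mem_Icc hδ hτ)]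
  have hi : IntervalIntegrable (fun t => h t m) volume 0 T :=
    (H.integrable_comp (measurable_const (a := m))).intervalIntegrable
  rw [h2, intervalIntegral.integral_sub intervalIntegrable_const hi,
    intervalIntegral.integral_const, smul_eq_mul] at h1
  linarith

/-- If the velocity argument stays positive on `[0,T]`, then the position increases. -/
theorem DelayOrbit.position_lt (hx : DelayOrbit T ψ F h s δ u z) (hT : 0 < T) (hδ : 0 ≤ δ)
    (hψ : Continuous ψ) (hF : Continuous F)
    (hpos : ∀ t ∈ Icc 0 T, 0 < ψ (z t - F (u t))) : u 0 < u T := by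
  have h1 := hx.position_sub hψ hF ⟨le_rfl, hT.le⟩ ⟨hT.le, le_rfl⟩
  have hc : Continuous fun τ : ℝ => ψ (z (max (τ - δ) 0) - F (u (max (τ - δ) 0))) :=
    hψ.comp ((continuous_delayed hx.2.1 δ).sub (hF.comp (continuous_delayed hx.1 δ)))
  have := intervalIntegral.intervalIntegral_pos_of_pos_on (hc.intervalIntegrable 0 T)
    (fun t ht => hpos _ (max_sub_mem_Icc hδ (Ioo_subset_Icc_self ht))) hT
  linarith

theorem DelayOrbit.lt_position (hx : DelayOrbit T ψ F h s δ u z) (hT : 0 < T) (hδ : 0 ≤ δ)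
    (hψ : Continuous ψ) (hF : Continuous F)
    (hneg : ∀ t ∈ Icc 0 T, ψ (z t - F (u t)) < 0) : u T < u 0 := by
  have h1 := hx.position_sub hψ hF ⟨le_rfl, hT.le⟩ ⟨hT.le, le_rfl⟩
  have hc : Continuous fun τ : ℝ => ψ (z (max (τ - δ) 0) - F (u (max (τ - δ) 0))) :=
    hψ.comp ((continuous_delayed hx.2.1 δ).sub (hF.comp (continuous_delayed hx.1 δ)))
  have := intervalIntegral.intervalIntegral_pos_of_pos_on (hc.neg.intervalIntegrable 0 T)
    (fun t ht => neg_pos.2 (hneg _ (max_sub_mem_Icc hδ (Ioo_subset_Icc_self ht)))) hT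
  simp only [Pi.neg_apply, intervalIntegral.integral_neg] at this
  linarith

/-- Solutions of the delayed problem with `u(0) = u(T)` for which the gap to `β` and the momentum
defect are complementary. -/
theorem exists_complementary_delayOrbit (hT : 0 < T) (hψ : Continuous ψ) (hψm : StrictMono ψ)
    (hψ0 : ψ 0 = 0) (hF : Continuous F) {A : ℝ} (hA : ∀ x, |F x| ≤ A)
    (H : DominatedCaratheodory h γ) (hβ : Continuous β) {D : ℝ}
    (hβD : ∀ t ∈ Icc 0 T, |β t| < D) (hup : ∀ t x, D ≤ x → h t x = h t D)
    (hlow : ∀ t x, x ≤ -D → h t x = h t (-D)) {κ : ℝ} (hκ : κ = 1 ∨ κ = -1)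
    (hs : s * T < ∫ t in (0:ℝ)..T, h t (κ * D)) :
    ∃ R, ∀ δ, 0 < δ → ∃ u z, DelayOrbit T ψ F h s δ u z ∧ |u 0| ≤ R ∧ |z 0| ≤ R ∧ u 0 = u T ∧
      min (κ * gap T β u) (z 0 - z T) = 0 := by
  set W := |s| * T + ∫ τ, γ τ with hW
  have hW0 : 0 ≤ W := by
    have : 0 ≤ ∫ τ, γ τ := integral_nonneg H.bound_nonneg
    positivity
  have hA0 : 0 ≤ A := (abs_nonneg _).trans (hA 0)
  set V := W + A + 1 with hV
  set Y := V + W + A with hY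
  obtain ⟨B, hB⟩ := (isCompact_Icc (a := -Y) (b := Y)).exists_bound_of_continuousOn
    hψ.continuousOn
  have hB0 : 0 ≤ B := (norm_nonneg _).trans (hB 0 ⟨by linarith, by linarith⟩)
  have hD0 : 0 < D := (abs_nonneg _).trans_lt (hβD 0 ⟨le_rfl, hT.le⟩)
  have hBT : 0 ≤ B * T := by positivity
  set C := D + B * T + 1 with hC
  refine ⟨max C V, fun δ hδ => ?_⟩
  obtain ⟨X, hXc, hX0, hX⟩ := exists_delayFlow hψ hF H T s hδ
  have h0I : (0:ℝ) ∈ Icc 0 T := ⟨le_rfl, hT.le⟩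
  have hTI : T ∈ Icc 0 T := ⟨hT.le, le_rfl⟩
  have hXt : ∀ t, Continuous fun p => X p t := fun t => hXc.comp (Continuous.prodMk_left t)
  have hz : ∀ p : ℝ × ℝ, ∀ t ∈ Icc 0 T, |(X p t).2 - p.2| ≤ W := by
    intro p t ht
    have := (hX p).abs_momentum_le H le_rfl ht
    simpa only [hX0] using this
  have hu : ∀ p : ℝ × ℝ, p.2 ∈ Icc (-V) V → ∀ t ∈ Icc 0 T, |(X p t).1 - p.1| ≤ B * T := by
    intro p hp t ht
    have := (hX p).abs_position_sub_le hψ hF hδ.le hB (fun τ hτ => by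
      have h1 := abs_le.1 (hz p τ hτ)
      have h2 := abs_le.1 (hA (X p τ).1)
      rw [abs_le]
      constructor <;> linarith [hp.1, hp.2]) h0I ht ht.1
    simp only [hX0, sub_zero] at this
    exact this.trans (by gcongr; exact ht.2)
  set P : ℝ × ℝ → ℝ := fun p => κ * min (κ * gap T β fun t => (X p t).1) (p.2 - (X p T).2) with hP
  have hPc : Continuous P := by
    have : Continuous fun p : ℝ × ℝ => gap T β fun t => (X p t).1 := by
      refine isCompact_Icc.continuous_sSup (f := fun p t => (X p t).1 - β t) ?_
      exact (continuous_fst.comp hXc).sub (hβ.comp continuous_snd)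
    exact continuous_const.mul ((continuous_const.mul this).min
      (continuous_snd.sub (continuous_snd.comp (hXt T))))
  have hleft : ∀ y ∈ Icc (-V) V, ∀ t ∈ Icc 0 T, (X (-C, y) t).1 ≤ -D - 1 := by
    intro y hy t ht
    have := abs_le.1 (hu (-C, y) hy t ht)
    simp only at this
    linarith
  have hright : ∀ y ∈ Icc (-V) V, ∀ t ∈ Icc 0 T, D + 1 ≤ (X (C, y) t).1 := by
    intro y hy t ht
    have := abs_le.1 (hu (C, y) hy t ht)
    simp only at this
    linarith
  have hgl : ∀ y ∈ Icc (-V) V, gap T β (fun t => (X (-C, y) t).1) < 0 := by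
    intro y hy
    obtain ⟨t, ht, he⟩ := exists_gap_eq hT.le hβ (hX (-C, y)).1
    rw [he]
    linarith [hleft y hy t ht, (abs_lt.1 (hβD t ht)).1]
  have hgr : ∀ y ∈ Icc (-V) V, 0 < gap T β (fun t => (X (C, y) t).1) := by
    intro y hy
    have := le_gap hβ (hX (C, y)).1 h0I
    linarith [hright y hy 0 h0I, (abs_lt.1 (hβD 0 h0I)).2]
  have hdef : ∀ p m, (∀ t ∈ Icc 0 T, ∀ τ, h τ (X p t).1 = h τ m) →
      (s * T < ∫ t in (0:ℝ)..T, h t m) → 0 < p.2 - (X p T).2 := by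
    intro p m hm hs
    have := (hX p).defect_pos hT.le hδ.le H hm hs
    simpa only [hX0] using this
  obtain ⟨x, hx, y, hy, hPx, hQx⟩ := poincare_miranda (a := -C) (b := C) (c := -V) (d := V)
    (by linarith) (by linarith) (P := P) (Q := fun p => (X p T).1 - p.1) hPc
    ((continuous_fst.comp (hXt T)).sub continuous_fst)
    (by
      intro y hy
      rcases hκ with rfl | rfl
      · simp only [hP, one_mul]
        exact (min_le_left _ _).trans_lt (hgl y hy)
      · simp only [hP, neg_one_mul, neg_lt_zero]
        refine lt_min (neg_pos.2 (hgl y hy)) (hdef (-C, y) _ (fun t ht τ => ?_) hs)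
        rw [neg_one_mul]
        exact hlow _ _ (by linarith [hleft y hy t ht]))
    (by
      intro y hy
      rcases hκ with rfl | rfl
      · simp only [hP, one_mul]
        refine lt_min (hgr y hy) (hdef (C, y) _ (fun t ht τ => ?_) hs)
        rw [one_mul]
        exact hup _ _ (by linarith [hright y hy t ht])
      · simp only [hP, neg_one_mul, neg_pos]
        exact (min_le_left _ _).trans_lt (neg_lt_zero.2 (hgr y hy)))
    (by
      intro x hx
      have := (hX (x, -V)).lt_position hT hδ.le hψ hF fun t ht => by
        rw [← hψ0]
        refine hψm ?_
        have h1 := abs_le.1 (hz (x, -V) t ht)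
        have h2 := abs_le.1 (hA (X (x, -V) t).1)
        simp only at h1
        linarith
      simp only [hX0] at this
      simpa using this)
    (by
      intro x hx
      have := (hX (x, V)).position_lt hT hδ.le hψ hF fun t ht => by
        rw [← hψ0]
        refine hψm ?_
        have h1 := abs_le.1 (hz (x, V) t ht)
        have h2 := abs_le.1 (hA (X (x, V) t).1)
        simp only at h1
        linarith
      simp only [hX0] at this
      simpa using this)
  refine ⟨_, _, hX (x, y), ?_, ?_, ?_, ?_⟩
  · simp only [hX0]
    exact (abs_le.2 hx).trans (le_max_left _ _)
  · simp only [hX0]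
    exact (abs_le.2 hy).trans (le_max_right _ _)
  · simp only [hX0]
    simp only at hQx
    linarith
  · simp only [hX0]
    have hκ0 : κ ≠ 0 := by rcases hκ with rfl | rfl <;> norm_num
    simpa [hP, hκ0] using hPx

/-- Existence of a periodic orbit on a prescribed side of a strict upper solution. -/
theorem exists_periodic_orbit_of_upperSolution (hT : 0 < T) (hφ : StrictMono φ)
    (hψ : Continuous ψ) (hφψ : ∀ y, φ (ψ y) = y) (hψ0 : ψ 0 = 0) (hF : Continuous F) {A L : ℝ}
    (hA : ∀ x, |F x| ≤ A) (hL : 0 ≤ L) (hFL : ∀ x y, |F x - F y| ≤ L * |x - y|)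
    (H : DominatedCaratheodory h γ) (hA0 : CondA0 T h) {s' : ℝ} (hs' : s' < s)
    (hβ : IsUpperSolution T φ F h s' β β') {D : ℝ}
    (hβD : ∀ t ∈ Icc 0 T, |β t| < D) (hup : ∀ t x, D ≤ x → h t x = h t D)
    (hlow : ∀ t x, x ≤ -D → h t x = h t (-D)) {κ : ℝ} (hκ : κ = 1 ∨ κ = -1)
    (hs : s * T < ∫ t in (0:ℝ)..T, h t (κ * D)) :
    ∃ u z, DelayOrbit T ψ F h s 0 u z ∧ u 0 = u T ∧ z 0 = z T ∧ 0 < κ * gap T β u := by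
  have hψm : StrictMono ψ := fun a b hab => by
    rw [← hφ.lt_iff_lt, hφψ, hφψ]; exact hab
  have h0I : (0:ℝ) ∈ Icc 0 T := ⟨le_rfl, hT.le⟩
  have hTI : T ∈ Icc 0 T := ⟨hT.le, le_rfl⟩
  obtain ⟨R, hR⟩ := exists_complementary_delayOrbit hT hψ hψm hψ0 hF hA H hβ.1 hβD hup hlow hκ hs
  have hpos : ∀ n : ℕ, (0:ℝ) < 1 / ((n:ℝ) + 1) := fun n => by positivity
  choose u z hx hu0 hz0 hper hmin using fun n : ℕ => hR (1 / ((n:ℝ) + 1)) (hpos n)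
  obtain ⟨v, w, k, hk, hvw, hv, hw⟩ := exists_limit_orbit hT.le hψ hF hA H hx
    (fun n => (hpos n).le) tendsto_one_div_add_atTop_nhds_zero_nat tendsto_const_nhds hu0 hz0
  have hvper : v 0 = v T := by
    refine tendsto_nhds_unique (hv.tendsto_at h0I) ?_
    simpa only [hper] using hv.tendsto_at hTI
  have hvmin : min (κ * gap T β v) (w 0 - w T) = 0 := by
    refine tendsto_nhds_unique (((tendsto_gap hT.le hβ.1 (fun n => (hx (k n)).1) hvw.1
      hv).const_mul κ).min ((hw.tendsto_at h0I).sub (hw.tendsto_at hTI))) ?_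
    simp only [hmin]
    exact tendsto_const_nhds
  have h1 : 0 ≤ κ * gap T β v := hvmin.ge.trans (min_le_left _ _)
  have h2 : 0 ≤ w 0 - w T := hvmin.ge.trans (min_le_right _ _)
  have h3 : gap T β v ≠ 0 := by
    intro h
    obtain ⟨t, ht, he⟩ := exists_gap_eq hT.le hβ.1 hvw.1
    have := hvw.lt_upperSolution hT hφ hψ hφψ hL hF hFL H hA0 hs' hβ hvper (by linarith)
      (fun τ hτ => by linarith [le_gap hβ.1 hvw.1 hτ]) ht
    linarith
  have hκ0 : κ ≠ 0 := by rcases hκ with rfl | rfl <;> norm_num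
  have h4 : 0 < κ * gap T β v := lt_of_le_of_ne h1 (mul_ne_zero hκ0 h3).symm
  refine ⟨v, w, hvw, hvper, ?_, h4⟩
  rcases min_choice (κ * gap T β v) (w 0 - w T) with h | h <;> linarith

end

section

open scoped Topology

variable {T : ℝ} {φ ψ f F : ℝ → ℝ} {g : ℝ → ℝ → ℝ} {s : ℝ} {u u' w : ℝ → ℝ}

theorem IsC1Periodic.continuousOn (hu : IsC1Periodic T u u') : ContinuousOn u (Icc 0 T) :=
  fun t ht => (hu.1 t ht).continuousWithinAt

theorem IsC1Periodic.neg (hu : IsC1Periodic T u u') :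
    IsC1Periodic T (fun t => -u t) (fun t => -u' t) :=
  ⟨fun t ht => (hu.1 t ht).neg, hu.2.1.neg, congrArg Neg.neg hu.2.2.1,
    congrArg Neg.neg hu.2.2.2⟩

theorem IsC1Periodic.hasDerivWithinAt_Ici (hu : IsC1Periodic T u u') {t : ℝ}
    (ht : t ∈ Ico 0 T) : HasDerivWithinAt u (u' t) (Ici t) t :=
  (hu.1 t (Ico_subset_Icc_self ht)).mono_of_mem_nhdsWithin (Icc_mem_nhdsGE_of_mem ht)

/-- The sign of the derivative of a `C¹` function at an endpoint-or-interior minimum. -/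
theorem IsC1Periodic.deriv_nonpos_of_min (hu : IsC1Periodic T u u') {t : ℝ} (ht : t ∈ Ioc 0 T)
    (hmin : ∀ r ∈ Icc 0 T, u t ≤ u r) : u' t ≤ 0 := by
  have hT : 0 ≤ T := ht.1.le.trans ht.2
  have hloc : IsLocalMinOn u (Icc 0 T) t := by
    filter_upwards [self_mem_nhdsWithin] with r hr using hmin r hr
  have htI := Ioc_subset_Icc_self ht
  have := hloc.hasFDerivWithinAt_nonneg (hu.1 t htI).hasFDerivWithinAt
    (sub_mem_posTangentConeAt_of_segment_subset
      ((convex_Icc 0 T).segment_subset htI ⟨le_rfl, hT⟩))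
  simp at this
  nlinarith [ht.1]

/-- A periodic function takes each of its values also with nonpositive slope. -/
theorem IsC1Periodic.exists_deriv_nonpos (hT : 0 < T) (hu : IsC1Periodic T u u') {t : ℝ}
    (ht : t ∈ Icc 0 T) : ∃ r ∈ Icc 0 T, u r = u t ∧ u' r ≤ 0 := by
  by_contra! hcon
  have hfence : ∀ a ∈ Icc 0 T, u t ≤ u a → ∀ r ∈ Icc a T, u t ≤ u r := by
    intro a ha hta
    refine image_le_of_deriv_right_lt_deriv_boundary' (f := fun _ => u t) (f' := fun _ => 0)
      continuousOn_const (fun x _ => hasDerivWithinAt_const _ _ _) hta (B' := u')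
      (hu.continuousOn.mono (Icc_subset_Icc_left ha.1))
      (fun x hx => hu.hasDerivWithinAt_Ici ⟨ha.1.trans hx.1, hx.2⟩)
      (fun x hx he => hcon x ⟨ha.1.trans hx.1, hx.2.le⟩ he.symm)
  have hmin : ∀ r ∈ Icc 0 T, u t ≤ u r :=
    hfence 0 ⟨le_rfl, hT.le⟩ (hu.2.2.1 ▸ hfence t ht le_rfl T ⟨ht.2, le_rfl⟩)
  rcases eq_or_lt_of_le ht.1 with h | h
  · subst h
    have h1 := hu.deriv_nonpos_of_min ⟨hT, le_rfl⟩ (by rwa [← hu.2.2.1])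
    have h2 := hcon T ⟨hT.le, le_rfl⟩ hu.2.2.1.symm
    linarith
  · have h1 := hu.deriv_nonpos_of_min ⟨h, ht.2⟩ hmin
    have h2 := hcon t ht rfl
    linarith

/-- A one-sided bound on the momentum increments controls the slope of a periodic function,
independently of the friction term. -/
theorem IsC1Periodic.abs_slope_le (hT : 0 < T) (hu : IsC1Periodic T u u') (hφ : StrictMono φ)
    (hφ0 : φ 0 = 0) {E : ℝ}
    (hE : ∀ a ∈ Icc 0 T, ∀ b ∈ Icc 0 T, a ≤ b →
      (φ (u' b) + F (u b)) - (φ (u' a) + F (u a)) ≤ E) {t : ℝ} (ht : t ∈ Icc 0 T) :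
    |φ (u' t)| ≤ 2 * E := by
  have h0 : (0:ℝ) ∈ Icc 0 T := ⟨le_rfl, hT.le⟩
  have hTI : T ∈ Icc 0 T := ⟨hT.le, le_rfl⟩
  have hall : ∀ a ∈ Icc 0 T, ∀ b ∈ Icc 0 T,
      (φ (u' b) + F (u b)) - (φ (u' a) + F (u a)) ≤ 2 * E := by
    intro a ha b hb
    have h1 := hE 0 h0 b hb hb.1
    have h2 := hE a ha T hTI ha.2
    rw [← hu.2.2.1, ← hu.2.2.2] at h2
    linarith
  obtain ⟨r, hr, hru, hr'⟩ := hu.exists_deriv_nonpos hT ht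
  obtain ⟨q, hq, hqu, hq'⟩ := hu.neg.exists_deriv_nonpos hT ht
  have hqu' : u q = u t := neg_injective hqu
  have e1 : φ (u' r) ≤ 0 := hφ0 ▸ hφ.monotone hr'
  have e2 : 0 ≤ φ (u' q) := hφ0 ▸ hφ.monotone (by linarith)
  have e3 := hall r hr t ht
  have e4 := hall t ht q hq
  rw [hru] at e3
  rw [hqu'] at e4
  rw [abs_le]
  constructor <;> linarith

/-- Fundamental theorem of calculus for the friction term. -/
theorem IsC1Periodic.integral_friction (hu : IsC1Periodic T u u') (hf : Continuous f)
    (hF : ∀ x, HasDerivAt F (f x) x) {a b : ℝ} (ha : a ∈ Icc 0 T) (hb : b ∈ Icc 0 T)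
    (hab : a ≤ b) :
    IntervalIntegrable (fun t => f (u t) * u' t) volume a b ∧
      ∫ t in a..b, f (u t) * u' t = F (u b) - F (u a) := by
  have hsub : Icc a b ⊆ Icc 0 T := Icc_subset_Icc ha.1 hb.2
  have hc : ContinuousOn (fun t => f (u t) * u' t) (Icc a b) :=
    ((hf.comp_continuousOn hu.continuousOn).mul hu.2.1).mono hsub
  have hi : IntervalIntegrable (fun t => f (u t) * u' t) volume a b :=
    (hc.mono (uIcc_of_le hab).le).intervalIntegrable
  refine ⟨hi, intervalIntegral.integral_eq_sub_of_hasDerivAt_of_le hab (f := fun t => F (u t))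
    ?_ (fun t ht => ?_) hi⟩
  · exact (continuous_iff_continuousAt.2 fun x => (hF x).continuousAt).comp_continuousOn
      (hu.continuousOn.mono hsub)
  · have htI : t ∈ Icc 0 T := hsub (Ioo_subset_Icc_self ht)
    have hd := (hu.1 t htI).hasDerivAt
      (Icc_mem_nhds (ha.1.trans_lt ht.1) (ht.2.trans_le hb.2))
    exact (hF (u t)).comp t hd

/-- The integrated (Liénard) form of the equation. -/
theorem IsACPhiDeriv.momentum_sub (hu : IsC1Periodic T u u') (hw : IsACPhiDeriv T φ u' w)
    (heq : ∀ᵐ t ∂(muT T), w t + f (u t) * u' t + g t (u t) = s) (hf : Continuous f)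
    (hF : ∀ x, HasDerivAt F (f x) x) {a b : ℝ} (ha : a ∈ Icc 0 T) (hb : b ∈ Icc 0 T)
    (hab : a ≤ b) :
    IntervalIntegrable (fun t => s - g t (u t)) volume a b ∧
      (φ (u' b) + F (u b)) - (φ (u' a) + F (u a)) = ∫ t in a..b, (s - g t (u t)) := by
  have hwi : ∀ a ∈ Icc 0 T, ∀ b ∈ Icc 0 T, IntervalIntegrable w volume a b := fun a ha b hb =>
    (hw.1.mono_set (uIcc_subset_Icc ha hb)).intervalIntegrable
  have h0 : (0:ℝ) ∈ Icc 0 T := ⟨le_rfl, ha.1.trans ha.2⟩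
  obtain ⟨hfi, hfr⟩ := hu.integral_friction hf hF ha hb hab
  have hae : ∀ᵐ t, t ∈ uIoc a b → w t + f (u t) * u' t = s - g t (u t) := by
    have := (ae_restrict_iff' measurableSet_Icc).1 heq
    filter_upwards [this] with t ht htm
    rw [uIoc_of_le hab] at htm
    linarith [ht ⟨ha.1.trans htm.1.le, htm.2.trans hb.2⟩]
  have hsum : IntervalIntegrable (fun t => w t + f (u t) * u' t) volume a b :=
    (hwi a ha b hb).add hfi
  refine ⟨hsum.congr_ae ((ae_restrict_iff' measurableSet_uIoc).2 hae), ?_⟩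
  rw [← intervalIntegral.integral_congr_ae hae, intervalIntegral.integral_add (hwi a ha b hb) hfi,
    hfr, hw.2 b hb, hw.2 a ha, ← intervalIntegral.integral_add_adjacent_intervals
      (hwi 0 h0 a ha) (hwi a ha b hb)]
  ring

theorem hasDerivAt_primitive (hf : Continuous f) (x : ℝ) :
    HasDerivAt (fun x => ∫ y in (0:ℝ)..x, f y) (f x) x :=
  intervalIntegral.integral_hasDerivAt_right (hf.intervalIntegrable _ _)
    (hf.stronglyMeasurableAtFilter _ _) hf.continuousAt

theorem IsSolEs.integral_eq (hT : 0 < T) (hf : Continuous f) (hu : IsSolEs T φ f g s u) :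
    IntegrableOn (fun t => g t (u t)) (Icc 0 T) ∧ ∫ t in Icc 0 T, g t (u t) = s * T := by
  obtain ⟨u', w, hu1, hw, heq⟩ := hu
  have h0 : (0:ℝ) ∈ Icc 0 T := ⟨le_rfl, hT.le⟩
  have hTI : T ∈ Icc 0 T := ⟨hT.le, le_rfl⟩
  obtain ⟨hi, he⟩ := hw.momentum_sub hu1 heq hf (hasDerivAt_primitive hf) h0 hTI hT.le
  have hi' : IntervalIntegrable (fun t => g t (u t)) volume 0 T := by
    simpa using (intervalIntegrable_const (c := s)).sub hi
  rw [intervalIntegral.integral_sub intervalIntegrable_const hi',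
    intervalIntegral.integral_const, smul_eq_mul, hu1.2.2.1, hu1.2.2.2] at he
  refine ⟨(intervalIntegrable_iff_integrableOn_Icc_of_le hT.le).1 hi', ?_⟩
  rw [integral_Icc_eq_integral_Ioc, ← intervalIntegral.integral_of_le hT.le]
  linarith

/-- A uniform bound for the oscillation of periodic solutions. -/
theorem exists_oscillation_bound (hT : 0 < T) (hφ : StrictMono φ) (hφs : Function.Surjective φ)
    (hφ0 : φ 0 = 0) {γ₀ : ℝ → ℝ} (hγ : IntegrableOn γ₀ (Icc 0 T))
    (hγ0 : ∀ᵐ t ∂(muT T), 0 ≤ γ₀ t) (S : ℝ) :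
    ∃ R, 0 ≤ R ∧ ∀ (f : ℝ → ℝ) (g : ℝ → ℝ → ℝ) (s : ℝ) (u : ℝ → ℝ), Continuous f → |s| ≤ S →
      (∀ᵐ t ∂(muT T), ∀ x : ℝ, -γ₀ t ≤ g t x) → IsSolEs T φ f g s u →
      ∀ a ∈ Icc 0 T, ∀ b ∈ Icc 0 T, |u b - u a| ≤ R := by
  set E := ∫ t in (0:ℝ)..T, (S + γ₀ t) with hE
  obtain ⟨y₁, hy₁⟩ := hφs (2 * E)
  obtain ⟨y₂, hy₂⟩ := hφs (-(2 * E))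
  set R := max |y₁| |y₂| with hR
  have hR0 : 0 ≤ R := (abs_nonneg _).trans (le_max_left _ _)
  refine ⟨R * T, by positivity, ?_⟩
  rintro f g s u hf hs hg ⟨u', w, hu, hw, heq⟩ a ha b hb
  have hγi : IntervalIntegrable (fun t => S + γ₀ t) volume 0 T :=
    intervalIntegrable_const.add ((intervalIntegrable_iff_integrableOn_Icc_of_le hT.le).2 hγ)
  have hS : 0 ≤ S := (abs_nonneg s).trans hs
  have hosc : ∀ a ∈ Icc 0 T, ∀ b ∈ Icc 0 T, a ≤ b →
      (φ (u' b) + ∫ y in (0:ℝ)..u b, f y) - (φ (u' a) + ∫ y in (0:ℝ)..u a, f y) ≤ E := by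
    intro a ha b hb hab
    obtain ⟨hi, he⟩ := hw.momentum_sub hu heq hf (hasDerivAt_primitive hf) ha hb hab
    have hsub : Icc a b ⊆ Icc 0 T := Icc_subset_Icc ha.1 hb.2
    have hle : ∫ t in a..b, (s - g t (u t)) ≤ ∫ t in a..b, (S + γ₀ t) := by
      refine intervalIntegral.integral_mono_ae_restrict hab hi (hγi.mono_set (by
        rwa [uIcc_of_le hab, uIcc_of_le hT.le])) ?_
      have := ae_restrict_of_ae_restrict_of_subset hsub hg
      filter_upwards [this] with t ht
      linarith [ht (u t), (le_abs_self s).trans hs]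
    rw [he]
    refine hle.trans ?_
    refine intervalIntegral.integral_mono_interval ha.1 hab hb.2 ?_ hγi
    have := ae_restrict_of_ae_restrict_of_subset (Ioc_subset_Icc_self (a := (0:ℝ)) (b := T)) hγ0
    filter_upwards [this] with t ht
    simp only [Pi.zero_apply]
    linarith
  have hslope : ∀ t ∈ Icc 0 T, ‖u' t‖ ≤ R := by
    intro t ht
    have h1 := abs_le.1 (hu.abs_slope_le hT hφ hφ0 (F := fun x => ∫ y in (0:ℝ)..x, f y) hosc ht)
    rw [← hy₂, ← hy₁, hφ.le_iff_le, hφ.le_iff_le] at h1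
    rw [Real.norm_eq_abs, abs_le]
    have h2 := (abs_le.1 (le_max_left |y₁| |y₂|)).2
    have h3 := (abs_le.1 (le_max_right |y₁| |y₂|)).1
    constructor <;> linarith [h1.1, h1.2]
  have := (convex_Icc 0 T).norm_image_sub_le_of_norm_hasDerivWithin_le hu.1 hslope ha hb
  rw [Real.norm_eq_abs, Real.norm_eq_abs] at this
  refine this.trans ?_
  gcongr
  rw [abs_le]
  constructor <;> linarith [ha.1, ha.2, hb.1, hb.2]

/-- The mean-value condition at `-∞` bounds the solutions for smaller parameters from below. -/
theorem IsSolEs.lower_bound (hT : 0 < T) (hf : Continuous f) (hu : IsSolEs T φ f g s u)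
    {σ d R : ℝ} (hs : s ≤ σ)
    (hd : ∀ u u' : ℝ → ℝ, IsC1Periodic T u u' → (∀ t ∈ Icc (0:ℝ) T, u t ≤ -d) →
      σ < (1 / T) * ∫ t in Icc (0:ℝ) T, g t (u t))
    (hR : ∀ a ∈ Icc 0 T, ∀ b ∈ Icc 0 T, |u b - u a| ≤ R) {t : ℝ} (ht : t ∈ Icc 0 T) :
    -(d + R) ≤ u t := by
  by_contra! hlt
  have hint := (hu.integral_eq hT hf).2
  obtain ⟨u', w, hu1, -, -⟩ := hu
  have := hd u u' hu1 fun r hr => by linarith [(abs_le.1 (hR t ht r hr)).2]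
  rw [hint] at this
  field_simp at this
  linarith

/-- The mean-value condition at `+∞` bounds the solutions for smaller parameters from above. -/
theorem IsSolEs.upper_bound (hT : 0 < T) (hf : Continuous f) (hu : IsSolEs T φ f g s u)
    {σ d R : ℝ} (hs : s ≤ σ)
    (hd : ∀ u u' : ℝ → ℝ, IsC1Periodic T u u' → (∀ t ∈ Icc (0:ℝ) T, d ≤ u t) →
      σ < (1 / T) * ∫ t in Icc (0:ℝ) T, g t (u t))
    (hR : ∀ a ∈ Icc 0 T, ∀ b ∈ Icc 0 T, |u b - u a| ≤ R) {t : ℝ} (ht : t ∈ Icc 0 T) :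
    u t ≤ d + R := by
  by_contra! hlt
  have hint := (hu.integral_eq hT hf).2
  obtain ⟨u', w, hu1, -, -⟩ := hu
  have := hd u u' hu1 fun r hr => by linarith [(abs_le.1 (hR t ht r hr)).1]
  rw [hint] at this
  field_simp at this
  linarith

end

section

open scoped Topology

variable {T : ℝ} {φ ψ f F : ℝ → ℝ} {g h : ℝ → ℝ → ℝ} {γ : ℝ → ℝ} {s : ℝ} {u z u' : ℝ → ℝ}

/-- Periodic orbits of the Liénard system are periodic solutions of the equation. -/
theorem DelayOrbit.isSolEs (hx : DelayOrbit T ψ F h s 0 u z) (hT : 0 < T) (hψ : Continuous ψ)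
    (hφψ : ∀ y, φ (ψ y) = y) (hf : Continuous f) (hF : ∀ x, HasDerivAt F (f x) x)
    (H : DominatedCaratheodory h γ) (hu : u 0 = u T) (hz : z 0 = z T) :
    IsSolEs T φ f h s u := by
  have hFc : Continuous F := continuous_iff_continuousAt.2 fun x => (hF x).continuousAt
  have hc : Continuous fun t => ψ (z t - F (u t)) := hψ.comp (hx.2.1.sub (hFc.comp hx.1))
  have h0 : (0:ℝ) ∈ Icc 0 T := ⟨le_rfl, hT.le⟩
  have hC1 : IsC1Periodic T u fun t => ψ (z t - F (u t)) :=
    ⟨fun t ht => hx.hasDerivWithinAt hψ hFc ht, hc.continuousOn, hu, by simp only [hu, hz]⟩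
  have hfi : ∀ a b, IntervalIntegrable (fun t => f (u t) * ψ (z t - F (u t))) volume a b :=
    fun a b => ((hf.comp hx.1).mul hc).intervalIntegrable a b
  have hi := H.intervalIntegrable s hx.1.measurable
  refine ⟨fun t => ψ (z t - F (u t)),
    fun t => (s - h t (u t)) - f (u t) * ψ (z t - F (u t)), hC1, ⟨?_, fun t ht => ?_⟩,
    Eventually.of_forall fun t => by ring⟩
  · exact (intervalIntegrable_iff_integrableOn_Icc_of_le hT.le).1 ((hi 0 T).sub (hfi 0 T))
  · rw [intervalIntegral.integral_sub (hi 0 t) (hfi 0 t), ← hx.integral_undelayed H h0 ht,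
      (hC1.integral_friction hf hF h0 ht ht.1).2, hφψ, hφψ]
    ring

theorem IsC1Periodic.congr (hu : IsC1Periodic T u u') (hT : 0 ≤ T) {v v' : ℝ → ℝ}
    (hv : EqOn v u (Icc 0 T)) (hv' : EqOn v' u' (Icc 0 T)) : IsC1Periodic T v v' := by
  have h0 : (0:ℝ) ∈ Icc 0 T := ⟨le_rfl, hT⟩
  have hTI : T ∈ Icc 0 T := ⟨hT, le_rfl⟩
  refine ⟨fun t ht => ?_, hu.2.1.congr hv', ?_, ?_⟩
  · rw [hv' ht]
    exact (hu.1 t ht).congr hv (hv ht)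
  · rw [hv h0, hv hTI, hu.2.2.1]
  · rw [hv' h0, hv' hTI, hu.2.2.2]

/-- The extension of a function on `[0,T]` that is constant outside. -/
def clampExtend (T : ℝ) (u : ℝ → ℝ) (t : ℝ) : ℝ := u (max 0 (min t T))

theorem clampExtend_eqOn (T : ℝ) (u : ℝ → ℝ) : EqOn (clampExtend T u) u (Icc 0 T) :=
  fun t ht => by simp [clampExtend, ht.1, ht.2]

theorem continuous_clampExtend (hT : 0 ≤ T) (hu : ContinuousOn u (Icc 0 T)) :
    Continuous (clampExtend T u) :=
  hu.comp_continuous (by fun_prop) fun _ => ⟨le_max_left _ _, max_le hT (min_le_right _ _)⟩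

/-- Periodic solutions of the equation are periodic orbits of the Liénard system. -/
theorem IsSolEs.exists_orbit (hu : IsSolEs T φ f h s u) (hT : 0 < T) (hφ : Continuous φ)
    (hψφ : ∀ y, ψ (φ y) = y) (hf : Continuous f) (hF : ∀ x, HasDerivAt F (f x) x) :
    ∃ v z, EqOn v u (Icc 0 T) ∧ DelayOrbit T ψ F h s 0 v z ∧ v 0 = v T ∧ z 0 = z T := by
  obtain ⟨u', w, hu1, hw, heq⟩ := hu
  have hFc : Continuous F := continuous_iff_continuousAt.2 fun x => (hF x).continuousAt
  have h0 : (0:ℝ) ∈ Icc 0 T := ⟨le_rfl, hT.le⟩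
  have hTI : T ∈ Icc 0 T := ⟨hT.le, le_rfl⟩
  have hv := clampExtend_eqOn T u
  have hv' := clampExtend_eqOn T u'
  have hvc := continuous_clampExtend hT.le hu1.continuousOn
  have hvc' := continuous_clampExtend hT.le hu1.2.1
  refine ⟨clampExtend T u, fun t => φ (clampExtend T u' t) + F (clampExtend T u t), hv,
    ⟨hvc, (hφ.comp hvc').add (hFc.comp hvc), fun t ht => ⟨?_, ?_⟩⟩, ?_, ?_⟩
  · have := (hu1.integral_friction (f := fun _ => 1) (F := fun x => x) continuous_const
      hasDerivAt_id' h0 ht ht.1).2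
    simp only [one_mul] at this
    have he : ∫ τ in (0:ℝ)..t, ψ (φ (clampExtend T u' (max (τ - 0) 0)) +
        F (clampExtend T u (max (τ - 0) 0)) - F (clampExtend T u (max (τ - 0) 0))) =
        ∫ τ in (0:ℝ)..t, u' τ := by
      refine intervalIntegral.integral_congr fun τ hτ => ?_
      rw [uIcc_of_le ht.1] at hτ
      simp only [add_sub_cancel_right, hψφ, sub_zero, max_eq_left hτ.1]
      exact hv' ⟨hτ.1, hτ.2.trans ht.2⟩
    rw [he, this, hv ht, hv h0]
    ring
  · have := (hw.momentum_sub hu1 heq hf hF h0 ht ht.1).2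
    have he : ∫ τ in (0:ℝ)..t, (s - h τ (clampExtend T u (max (τ - 0) 0))) =
        ∫ τ in (0:ℝ)..t, (s - h τ (u τ)) := by
      refine intervalIntegral.integral_congr fun τ hτ => ?_
      rw [uIcc_of_le ht.1] at hτ
      simp only [sub_zero, max_eq_left hτ.1]
      rw [hv ⟨hτ.1, hτ.2.trans ht.2⟩]
    simp only
    rw [he, ← this, hv ht, hv h0, hv' ht, hv' h0]
    ring
  · rw [hv h0, hv hTI, hu1.2.2.1]
  · simp only
    rw [hv h0, hv hTI, hu1.2.2.1, hv' h0, hv' hTI, hu1.2.2.2]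

/-- A bound for the initial momentum of periodic orbits. -/
theorem DelayOrbit.abs_momentum_zero_le (hx : DelayOrbit T ψ F h s 0 u z) (hT : 0 < T)
    (hψ : Continuous ψ) (hψm : StrictMono ψ) (hψ0 : ψ 0 = 0) (hF : Continuous F) {A : ℝ}
    (hA : ∀ x, |F x| ≤ A) (H : DominatedCaratheodory h γ) {S : ℝ} (hS : |s| ≤ S)
    (hu : u 0 = u T) : |z 0| ≤ A + (S * T + ∫ τ, γ τ) := by
  obtain ⟨t, ht, he⟩ := exists_hasDerivAt_eq_zero (f' := fun t => ψ (z t - F (u t))) hT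
    hx.1.continuousOn hu fun t ht =>
      (hx.hasDerivWithinAt hψ hF (Ioo_subset_Icc_self ht)).hasDerivAt (Icc_mem_nhds ht.1 ht.2)
  have h1 : z t - F (u t) = 0 := hψm.injective (he.trans hψ0.symm)
  have h2 := abs_le.1 (hx.abs_momentum_le H hS (Ioo_subset_Icc_self ht))
  have h3 := abs_le.1 (hA (u t))
  rw [abs_le]
  constructor <;> linarith

theorem IsSolEs.congr {f₁ : ℝ → ℝ} (hu : IsSolEs T φ f g s u)
    (hf : ∀ t ∈ Icc 0 T, f₁ (u t) = f (u t)) (hg : ∀ᵐ t ∂(muT T), h t (u t) = g t (u t)) :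
    IsSolEs T φ f₁ h s u := by
  obtain ⟨u', w, hu1, hw, heq⟩ := hu
  refine ⟨u', w, hu1, hw, ?_⟩
  filter_upwards [heq, hg, ae_restrict_mem measurableSet_Icc] with t h1 h2 h3
  rw [h2, hf t h3, h1]

/-- The derivative of `trunc D`. -/
def truncSlope (D x : ℝ) : ℝ := max 0 (min 1 (D + 1 - |x|))

/-- A bounded `C¹` function which is the identity on `[-D, D]`. -/
def trunc (D x : ℝ) : ℝ := ∫ y in (0:ℝ)..x, truncSlope D y

variable {D : ℝ}

theorem continuous_truncSlope (D : ℝ) : Continuous (truncSlope D) := by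
  unfold truncSlope
  fun_prop

theorem truncSlope_nonneg (D x : ℝ) : 0 ≤ truncSlope D x := le_max_left _ _

theorem truncSlope_le_one (D x : ℝ) : truncSlope D x ≤ 1 :=
  max_le zero_le_one (min_le_left _ _)

theorem truncSlope_of_abs_le {x : ℝ} (hx : |x| ≤ D) : truncSlope D x = 1 := by
  rw [truncSlope, min_eq_left (by linarith), max_eq_right zero_le_one]

theorem truncSlope_of_le_abs {x : ℝ} (hx : D + 1 ≤ |x|) : truncSlope D x = 0 :=
  max_eq_left ((min_le_right _ _).trans (by linarith))

theorem hasDerivAt_trunc (D x : ℝ) : HasDerivAt (trunc D) (truncSlope D x) x :=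
  hasDerivAt_primitive (continuous_truncSlope D) x

theorem continuous_trunc (D : ℝ) : Continuous (trunc D) :=
  continuous_iff_continuousAt.2 fun x => (hasDerivAt_trunc D x).continuousAt

theorem trunc_sub (D x y : ℝ) : trunc D y - trunc D x = ∫ r in x..y, truncSlope D r :=
  intervalIntegral.integral_interval_sub_left
    ((continuous_truncSlope D).intervalIntegrable _ _)
    ((continuous_truncSlope D).intervalIntegrable _ _)

theorem monotone_trunc (D : ℝ) : Monotone (trunc D) := fun x y hxy => by
  have := intervalIntegral.integral_nonneg (μ := volume) hxy fun r _ => truncSlope_nonneg D r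
  linarith [trunc_sub D x y]

theorem abs_trunc_sub_le (D x y : ℝ) : |trunc D x - trunc D y| ≤ |x - y| := by
  rw [trunc_sub]
  have := intervalIntegral.norm_integral_le_of_norm_le_const (a := y) (b := x) (C := 1)
    (f := truncSlope D) fun r _ => by
      rw [Real.norm_eq_abs, abs_of_nonneg (truncSlope_nonneg D r)]
      exact truncSlope_le_one D r
  simpa using this

theorem trunc_zero (D : ℝ) : trunc D 0 = 0 := by simp [trunc]

theorem trunc_of_abs_le {x : ℝ} (hx : |x| ≤ D) : trunc D x = x := by
  have : trunc D x = ∫ _ in (0:ℝ)..x, (1:ℝ) := by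
    refine intervalIntegral.integral_congr fun r hr => truncSlope_of_abs_le ?_
    have := abs_sub_left_of_mem_uIcc hr
    simp only [sub_zero] at this
    exact this.trans hx
  rw [this]
  simp

theorem trunc_of_ge {x : ℝ} (hx : D + 1 ≤ x) : trunc D x = trunc D (D + 1) := by
  have h1 : ∫ r in (D + 1)..x, truncSlope D r = ∫ _ in (D + 1)..x, (0:ℝ) := by
    refine intervalIntegral.integral_congr fun r hr => truncSlope_of_le_abs ?_
    rw [uIcc_of_le hx] at hr
    exact hr.1.trans (le_abs_self r)
  have := trunc_sub D (D + 1) x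
  rw [h1, intervalIntegral.integral_zero] at this
  linarith

theorem trunc_of_le {x : ℝ} (hx : x ≤ -(D + 1)) :
    trunc D x = trunc D (-(D + 1)) := by
  have h1 : ∫ r in x..(-(D + 1)), truncSlope D r = ∫ _ in x..(-(D + 1)), (0:ℝ) := by
    refine intervalIntegral.integral_congr fun r hr => truncSlope_of_le_abs ?_
    rw [uIcc_of_le hx] at hr
    linarith [hr.2, neg_le_abs r]
  have := trunc_sub D x (-(D + 1))
  rw [h1, intervalIntegral.integral_zero] at this
  linarith

theorem abs_trunc_le (hD : 0 ≤ D) (x : ℝ) : |trunc D x| ≤ D + 1 := by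
  have h1 := abs_le.1 (abs_trunc_sub_le D (D + 1) 0)
  have h2 := abs_le.1 (abs_trunc_sub_le D (-(D + 1)) 0)
  rw [trunc_zero, sub_zero, sub_zero] at h1 h2
  rw [abs_of_nonneg (by linarith : 0 ≤ D + 1)] at h1
  rw [abs_neg, abs_of_nonneg (by linarith : 0 ≤ D + 1)] at h2
  rw [abs_le]
  rcases le_total x (D + 1) with h | h
  · refine ⟨?_, (monotone_trunc D h).trans h1.2⟩
    rcases le_total x (-(D + 1)) with h' | h'
    · rw [trunc_of_le h']; exact h2.1
    · exact h2.1.trans (monotone_trunc D h')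
  · rw [trunc_of_ge h]; exact h1

theorem IsC1Periodic.trunc (hu : IsC1Periodic T u u') (D : ℝ) :
    IsC1Periodic T (fun t => trunc D (u t)) (fun t => truncSlope D (u t) * u' t) :=
  ⟨fun t ht => (hasDerivAt_trunc D (u t)).comp_hasDerivWithinAt t (hu.1 t ht),
    ((continuous_truncSlope D).comp_continuousOn hu.continuousOn).mul hu.2.1,
    by simp only [hu.2.2.1], by simp only [hu.2.2.1, hu.2.2.2]⟩

/-- A Carathéodory function agrees, after truncation of the second variable, with one dominated
by a single integrable function. -/
theorem Caratheodory.exists_truncation (hg : Caratheodory T g) (hD : 0 ≤ D) :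
    ∃ h γ, DominatedCaratheodory h γ ∧ (∀ᵐ t ∂(muT T), ∀ x, h t x = g t (trunc D x)) ∧
      (∀ t x, D + 1 ≤ x → h t x = h t (D + 1)) ∧
      ∀ t x, x ≤ -(D + 1) → h t x = h t (-(D + 1)) := by
  obtain ⟨hmeas, hcont, hdom⟩ := hg
  obtain ⟨γ, hγ, hbd⟩ := hdom (D + 1) (by linarith)
  obtain ⟨S, hS, hSm, hSg⟩ := (hcont.and hbd).exists_measurable_mem
  classical
  refine ⟨fun t x => if t ∈ S ∩ Icc 0 T then g t (trunc D x) else 0,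
    (S ∩ Icc 0 T).indicator γ, ⟨fun t => ?_, fun x => ?_, fun t x => ?_, ?_⟩, ?_, ?_, ?_⟩
  · by_cases ht : t ∈ S ∩ Icc 0 T
    · simp only [ht, if_true]
      exact (hSg t ht.1).1.comp (continuous_trunc D)
    · simp only [ht, if_false]
      exact continuous_const
  · exact Measurable.ite (hSm.inter measurableSet_Icc) (hmeas _) measurable_const
  · by_cases ht : t ∈ S ∩ Icc 0 T
    · simp only [ht, if_true, indicator_of_mem]
      exact (hSg t ht.1).2 _ (abs_trunc_le hD x)
    · simp [ht]
  · rw [integrable_indicator_iff (hSm.inter measurableSet_Icc)]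
    exact hγ.mono_set inter_subset_right
  · filter_upwards [hS, ae_restrict_mem measurableSet_Icc] with t h1 h2 x
    simp only [mem_inter_iff, h1, h2, and_self, if_true]
  · intro t x hx
    simp only [trunc_of_ge hx]
  · intro t x hx
    simp only [trunc_of_le hx]

theorem CondA0.congr_trunc (hg : CondA0 T g) (D : ℝ)
    (hh : ∀ᵐ t ∂(muT T), ∀ x, h t x = g t (trunc D x)) : CondA0 T h := by
  intro t₀ ht₀ x₀ ε hε
  obtain ⟨δ, hδ, hae⟩ := hg t₀ ht₀ (trunc D x₀) ε hε
  refine ⟨δ, hδ, ?_⟩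
  filter_upwards [hae, hh] with t h1 h2 ht x hx
  rw [h2, h2]
  exact h1 ht _ ((abs_trunc_sub_le D x x₀).trans_lt hx)

/-- Truncating the argument makes a `C¹` primitive bounded and Lipschitz. -/
theorem exists_bounds_truncated_friction (hf : Continuous f) (hF : ∀ x, HasDerivAt F (f x) x)
    (hD : 0 ≤ D) :
    ∃ A L, 0 ≤ L ∧ (∀ x, |F (trunc D x)| ≤ A) ∧
      ∀ x y, |F (trunc D x) - F (trunc D y)| ≤ L * |x - y| := by
  have hFc : Continuous F := continuous_iff_continuousAt.2 fun x => (hF x).continuousAt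
  obtain ⟨A, hA⟩ := (isCompact_Icc (a := -(D + 1)) (b := D + 1)).exists_bound_of_continuousOn
    hFc.continuousOn
  obtain ⟨L, hL⟩ := (isCompact_Icc (a := -(D + 1)) (b := D + 1)).exists_bound_of_continuousOn
    hf.continuousOn
  have hL0 : 0 ≤ L := (norm_nonneg _).trans (hL 0 ⟨by linarith, by linarith⟩)
  have hmem := fun x => abs_le.1 (abs_trunc_le hD x)
  refine ⟨A, L, hL0, fun x => hA _ (hmem x), fun x y => ?_⟩
  have := (convex_Icc (-(D + 1)) (D + 1)).norm_image_sub_le_of_norm_hasDerivWithin_le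
    (fun x _ => (hF x).hasDerivWithinAt) hL (hmem y) (hmem x)
  rw [Real.norm_eq_abs, Real.norm_eq_abs] at this
  exact this.trans (mul_le_mul_of_nonneg_left (abs_trunc_sub_le D x y) hL0)

end

section

open scoped Topology

variable {T : ℝ} {φ ψ f F : ℝ → ℝ} {g h : ℝ → ℝ → ℝ} {γ γ₀ : ℝ → ℝ} {s σ d D : ℝ}
  {u β β' : ℝ → ℝ}

/-- The mean of `g(t,u(t))` exceeds `σ` for every `u ∈ C¹_T` with `u ≤ -d`. -/
def MeanBelow (T : ℝ) (g : ℝ → ℝ → ℝ) (σ d : ℝ) : Prop :=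
  ∀ u u' : ℝ → ℝ, IsC1Periodic T u u' → (∀ t ∈ Icc (0:ℝ) T, u t ≤ -d) →
    σ < (1 / T) * ∫ t in Icc (0:ℝ) T, g t (u t)

/-- The mean of `g(t,u(t))` exceeds `σ` for every `u ∈ C¹_T` with `u ≥ d`. -/
def MeanAbove (T : ℝ) (g : ℝ → ℝ → ℝ) (σ d : ℝ) : Prop :=
  ∀ u u' : ℝ → ℝ, IsC1Periodic T u u' → (∀ t ∈ Icc (0:ℝ) T, d ≤ u t) →
    σ < (1 / T) * ∫ t in Icc (0:ℝ) T, g t (u t)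

theorem isC1Periodic_const (T c : ℝ) : IsC1Periodic T (fun _ => c) fun _ => 0 :=
  ⟨fun _ _ => hasDerivWithinAt_const _ _ _, continuousOn_const, rfl, rfl⟩

theorem MeanBelow.congr_trunc (hg : MeanBelow T g σ d) (hd : 0 ≤ d) (hD : d ≤ D)
    (hh : ∀ᵐ t ∂(muT T), ∀ x, h t x = g t (trunc D x)) : MeanBelow T h σ d := by
  intro u u' hu hle
  have he : ∫ t in Icc 0 T, h t (u t) = ∫ t in Icc 0 T, g t (trunc D (u t)) :=
    integral_congr_ae (hh.mono fun t ht => ht (u t))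
  rw [he]
  refine hg _ _ (hu.trunc D) fun t ht => ?_
  rw [← trunc_of_abs_le (x := -d) (D := D) (by rwa [abs_neg, abs_of_nonneg hd])]
  exact monotone_trunc D (hle t ht)

theorem MeanAbove.congr_trunc (hg : MeanAbove T g σ d) (hd : 0 ≤ d) (hD : d ≤ D)
    (hh : ∀ᵐ t ∂(muT T), ∀ x, h t x = g t (trunc D x)) : MeanAbove T h σ d := by
  intro u u' hu hle
  have he : ∫ t in Icc 0 T, h t (u t) = ∫ t in Icc 0 T, g t (trunc D (u t)) :=
    integral_congr_ae (hh.mono fun t ht => ht (u t))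
  rw [he]
  refine hg _ _ (hu.trunc D) fun t ht => ?_
  rw [← trunc_of_abs_le (x := d) (D := D) (by rwa [abs_of_nonneg hd])]
  exact monotone_trunc D (hle t ht)

theorem MeanBelow.lt_integral (hg : MeanBelow T g σ d) (hT : 0 < T) (hs : s ≤ σ) {c : ℝ}
    (hc : c ≤ -d) : s * T < ∫ t in (0:ℝ)..T, g t c := by
  have := hg _ _ (isC1Periodic_const T c) fun _ _ => hc
  rw [integral_Icc_eq_integral_Ioc, ← intervalIntegral.integral_of_le hT.le,
    one_div_mul_eq_div, lt_div_iff₀ hT] at this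
  nlinarith

theorem MeanAbove.lt_integral (hg : MeanAbove T g σ d) (hT : 0 < T) (hs : s ≤ σ) {c : ℝ}
    (hc : d ≤ c) : s * T < ∫ t in (0:ℝ)..T, g t c := by
  have := hg _ _ (isC1Periodic_const T c) fun _ _ => hc
  rw [integral_Icc_eq_integral_Ioc, ← intervalIntegral.integral_of_le hT.le,
    one_div_mul_eq_div, lt_div_iff₀ hT] at this
  nlinarith

theorem exists_continuous_inverse (hφ : StrictMono φ) (hφs : Function.Surjective φ)
    (hφ0 : φ 0 = 0) : ∃ ψ : ℝ → ℝ, Continuous ψ ∧ StrictMono ψ ∧ (∀ y, φ (ψ y) = y) ∧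
      (∀ y, ψ (φ y) = y) ∧ ψ 0 = 0 := by
  set e := hφ.orderIsoOfSurjective φ hφs with he
  refine ⟨e.symm, e.symm.continuous, e.symm.strictMono, e.apply_symm_apply, e.symm_apply_apply,
    ?_⟩
  rw [OrderIso.symm_apply_eq]
  exact hφ0.symm

/-- A lower bound on `g` which is inherited by truncations. -/
theorem ae_le_of_trunc (hg : ∀ᵐ t ∂(muT T), ∀ x : ℝ, -γ₀ t ≤ g t x)
    (hh : ∀ᵐ t ∂(muT T), ∀ x, h t x = g t (trunc D x)) :
    ∀ᵐ t ∂(muT T), ∀ x : ℝ, -γ₀ t ≤ h t x := by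
  filter_upwards [hg, hh] with t h1 h2 x
  rw [h2]
  exact h1 _

/-- `β` satisfies, in integrated form, the inequality defining upper solutions. -/
def IsUpperFunction (T : ℝ) (φ F : ℝ → ℝ) (g : ℝ → ℝ → ℝ) (s : ℝ) (β β' : ℝ → ℝ) : Prop :=
  IsC1Periodic T β β' ∧ ∀ a ∈ Icc 0 T, ∀ b ∈ Icc 0 T, a ≤ b →
    (φ (β' b) + F (β b)) - (φ (β' a) + F (β a)) ≤ ∫ τ in a..b, (s - g τ (β τ))

theorem IsUpperFunction.truncate (hβ : IsUpperFunction T φ F g s β β') (hT : 0 ≤ T)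
    (hβD : ∀ t ∈ Icc 0 T, |β t| ≤ D) (hh : ∀ᵐ t ∂(muT T), ∀ x, h t x = g t (trunc D x)) :
    IsUpperSolution T φ (fun x => F (trunc D x)) h s (clampExtend T β) β' := by
  have he := clampExtend_eqOn T β
  refine ⟨continuous_clampExtend hT hβ.1.continuousOn, hβ.1.congr hT he fun _ _ => rfl,
    fun a ha b hb hab => ?_⟩
  have hint : ∫ τ in a..b, (s - h τ (clampExtend T β τ)) = ∫ τ in a..b, (s - g τ (β τ)) := by
    refine intervalIntegral.integral_congr_ae ?_
    filter_upwards [(ae_restrict_iff' measurableSet_Icc).1 hh] with τ h1 h2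
    rw [uIoc_of_le hab] at h2
    have hτ : τ ∈ Icc 0 T := ⟨ha.1.trans h2.1.le, h2.2.trans hb.2⟩
    rw [h1 hτ, he hτ, trunc_of_abs_le (hβD τ hτ)]
  simp only [hint, he ha, he hb, trunc_of_abs_le (hβD a ha), trunc_of_abs_le (hβD b hb)]
  exact hβ.2 a ha b hb hab

theorem IsSolEs.untruncate
    (hu : IsSolEs T φ (fun x => f (trunc D x) * truncSlope D x) h s u)
    (hh : ∀ᵐ t ∂(muT T), ∀ x, h t x = g t (trunc D x)) (huD : ∀ t ∈ Icc 0 T, |u t| ≤ D) :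
    IsSolEs T φ f g s u := by
  refine hu.congr (fun t ht => ?_) ?_
  · rw [trunc_of_abs_le (huD t ht), truncSlope_of_abs_le (huD t ht), mul_one]
  · filter_upwards [hh, ae_restrict_mem measurableSet_Icc] with t h1 h2
    rw [h1, trunc_of_abs_le (huD t h2)]

theorem IsSolEs.truncate (hu : IsSolEs T φ f g s u)
    (hh : ∀ᵐ t ∂(muT T), ∀ x, h t x = g t (trunc D x)) (huD : ∀ t ∈ Icc 0 T, |u t| ≤ D) :
    IsSolEs T φ (fun x => f (trunc D x) * truncSlope D x) h s u := by
  refine hu.congr (fun t ht => ?_) ?_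
  · rw [trunc_of_abs_le (huD t ht), truncSlope_of_abs_le (huD t ht), mul_one]
  · filter_upwards [hh, ae_restrict_mem measurableSet_Icc] with t h1 h2
    rw [h1, trunc_of_abs_le (huD t h2)]

theorem continuous_truncated_friction (hf : Continuous f) (D : ℝ) :
    Continuous fun x => f (trunc D x) * truncSlope D x :=
  (hf.comp (continuous_trunc D)).mul (continuous_truncSlope D)

theorem hasDerivAt_truncated_primitive (hF : ∀ x, HasDerivAt F (f x) x) (D x : ℝ) :
    HasDerivAt (fun x => F (trunc D x)) (f (trunc D x) * truncSlope D x) x :=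
  (hF (trunc D x)).comp x (hasDerivAt_trunc D x)

/-- Periodic solutions of the truncated equation on a prescribed side of a strict upper
solution. -/
theorem exists_truncated_solution (hT : 0 < T) (hφ : StrictMono φ)
    (hφs : Function.Surjective φ) (hφ0 : φ 0 = 0) (hf : Continuous f)
    (hF : ∀ x, HasDerivAt F (f x) x) (hA0 : CondA0 T g) {s' : ℝ} (hs' : s' < s)
    (hβ : IsUpperFunction T φ F g s' β β') (hD : 0 ≤ D) (hβD : ∀ t ∈ Icc 0 T, |β t| ≤ D)
    (H : DominatedCaratheodory h γ) (hh : ∀ᵐ t ∂(muT T), ∀ x, h t x = g t (trunc D x))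
    (hup : ∀ t x, D + 1 ≤ x → h t x = h t (D + 1))
    (hlow : ∀ t x, x ≤ -(D + 1) → h t x = h t (-(D + 1))) {κ : ℝ} (hκ : κ = 1 ∨ κ = -1)
    (hs : s * T < ∫ t in (0:ℝ)..T, h t (κ * (D + 1))) :
    ∃ u, Continuous u ∧ IsSolEs T φ (fun x => f (trunc D x) * truncSlope D x) h s u ∧
      0 < κ * gap T (clampExtend T β) u := by
  obtain ⟨ψ, hψ, -, hφψ, -, hψ0⟩ := exists_continuous_inverse hφ hφs hφ0
  obtain ⟨A, L, hL, hA, hFL⟩ := exists_bounds_truncated_friction hf hF hD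
  have hF' := hasDerivAt_truncated_primitive hF D
  have hFc : Continuous fun x => F (trunc D x) :=
    continuous_iff_continuousAt.2 fun x => (hF' x).continuousAt
  obtain ⟨u, z, hx, hu, hz, hgap⟩ := exists_periodic_orbit_of_upperSolution hT hφ hψ hφψ hψ0 hFc
    hA hL hFL H (hA0.congr_trunc D hh) hs' (hβ.truncate hT.le hβD hh)
    (fun t ht => by rw [clampExtend_eqOn T β ht]; linarith [hβD t ht]) hup hlow hκ hs
  exact ⟨u, hx.1, hx.isSolEs hT hψ hφψ (continuous_truncated_friction hf D) hF' H hu hz, hgap⟩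

theorem IsUpperFunction.exists_bound (hβ : IsUpperFunction T φ F g s β β') :
    ∃ M, 0 ≤ M ∧ ∀ t ∈ Icc 0 T, |β t| ≤ M := by
  obtain ⟨M, hM⟩ := (isCompact_Icc (a := (0:ℝ)) (b := T)).exists_bound_of_continuousOn
    hβ.1.continuousOn
  exact ⟨max M 0, le_max_right _ _, fun t ht => (hM t ht).trans (le_max_left _ _)⟩

/-- Existence of a periodic solution below a strict upper solution. -/
theorem exists_solution_lt (hT : 0 < T) (hφ : StrictMono φ)
    (hφs : Function.Surjective φ) (hφ0 : φ 0 = 0) (hf : Continuous f)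
    (hF : ∀ x, HasDerivAt F (f x) x) (hg : Caratheodory T g) (hA0 : CondA0 T g)
    (hγ : IntegrableOn γ₀ (Icc 0 T)) (hγ0 : ∀ᵐ t ∂(muT T), 0 ≤ γ₀ t)
    (hgγ : ∀ᵐ t ∂(muT T), ∀ x : ℝ, -γ₀ t ≤ g t x) (hd : 0 ≤ d) (hσ : MeanBelow T g σ d)
    (hsσ : s ≤ σ) {s' : ℝ} (hs' : s' < s) (hβ : IsUpperFunction T φ F g s' β β') :
    ∃ u, IsSolEs T φ f g s u ∧ ∀ t ∈ Icc 0 T, u t < β t := by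
  obtain ⟨R, hR0, hR⟩ := exists_oscillation_bound hT hφ hφs hφ0 hγ hγ0 |s|
  obtain ⟨M, hM0, hM⟩ := hβ.exists_bound
  have hD : 0 ≤ d + R + M := by linarith
  obtain ⟨h, γ, H, hh, hup, hlow⟩ := hg.exists_truncation hD
  have hσ' := hσ.congr_trunc hd (by linarith) hh
  obtain ⟨u, huc, hu, hgap⟩ := exists_truncated_solution hT hφ hφs hφ0 hf hF hA0 hs' hβ hD
    (fun t ht => (hM t ht).trans (by linarith)) H hh hup hlow (Or.inr rfl)
    (hσ'.lt_integral hT hsσ (by linarith))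
  have hlt : ∀ t ∈ Icc 0 T, u t < β t := fun t ht => by
    have := le_gap (continuous_clampExtend hT.le hβ.1.continuousOn) huc ht
    rw [clampExtend_eqOn T β ht] at this
    linarith
  have hfc := continuous_truncated_friction hf (d + R + M)
  refine ⟨u, hu.untruncate hh fun t ht => abs_le.2 ⟨?_, ?_⟩, hlt⟩
  · have := hu.lower_bound hT hfc hsσ hσ' (hR _ _ _ _ hfc le_rfl (ae_le_of_trunc hgγ hh) hu) ht
    linarith
  · linarith [hlt t ht, (abs_le.1 (hM t ht)).2]

/-- Existence of a periodic solution exceeding a strict upper solution somewhere. -/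
theorem exists_solution_gt (hT : 0 < T) (hφ : StrictMono φ)
    (hφs : Function.Surjective φ) (hφ0 : φ 0 = 0) (hf : Continuous f)
    (hF : ∀ x, HasDerivAt F (f x) x) (hg : Caratheodory T g) (hA0 : CondA0 T g)
    (hγ : IntegrableOn γ₀ (Icc 0 T)) (hγ0 : ∀ᵐ t ∂(muT T), 0 ≤ γ₀ t)
    (hgγ : ∀ᵐ t ∂(muT T), ∀ x : ℝ, -γ₀ t ≤ g t x) (hd : 0 ≤ d) (hσ : MeanBelow T g σ d)
    (hsσ : s ≤ σ) {ρ e : ℝ} (he : 0 ≤ e) (hρ : MeanAbove T g ρ e) (hsρ : s ≤ ρ) {s' : ℝ}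
    (hs' : s' < s) (hβ : IsUpperFunction T φ F g s' β β') :
    ∃ u, IsSolEs T φ f g s u ∧ ∃ t ∈ Icc 0 T, β t < u t := by
  obtain ⟨R, hR0, hR⟩ := exists_oscillation_bound hT hφ hφs hφ0 hγ hγ0 |s|
  obtain ⟨M, hM0, hM⟩ := hβ.exists_bound
  have hD : 0 ≤ d + e + R + M := by linarith
  obtain ⟨h, γ, H, hh, hup, hlow⟩ := hg.exists_truncation hD
  have hσ' := hσ.congr_trunc hd (by linarith) hh
  have hρ' := hρ.congr_trunc he (by linarith) hh
  obtain ⟨u, huc, hu, hgap⟩ := exists_truncated_solution hT hφ hφs hφ0 hf hF hA0 hs' hβ hD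
    (fun t ht => (hM t ht).trans (by linarith)) H hh hup hlow (Or.inl rfl)
    (hρ'.lt_integral hT hsρ (by linarith))
  have hfc := continuous_truncated_friction hf (d + e + R + M)
  have hosc := hR _ _ _ _ hfc le_rfl (ae_le_of_trunc hgγ hh) hu
  refine ⟨u, hu.untruncate hh fun t ht => abs_le.2 ⟨?_, ?_⟩, ?_⟩
  · linarith [hu.lower_bound hT hfc hsσ hσ' hosc ht]
  · linarith [hu.upper_bound hT hfc hsρ hρ' hosc ht]
  · obtain ⟨t, ht, hte⟩ := exists_gap_eq hT.le
      (continuous_clampExtend hT.le hβ.1.continuousOn) huc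
    rw [clampExtend_eqOn T β ht] at hte
    exact ⟨t, ht, by linarith⟩

theorem IsSolEs.exists_isUpperFunction (hu : IsSolEs T φ f g s u) (hf : Continuous f)
    (hF : ∀ x, HasDerivAt F (f x) x) : ∃ u', IsUpperFunction T φ F g s u u' := by
  obtain ⟨u', w, hu1, hw, heq⟩ := hu
  exact ⟨u', hu1, fun a ha b hb hab => (hw.momentum_sub hu1 heq hf hF ha hb hab).2.le⟩

theorem isUpperFunction_const {u₀ g₀ : ℝ}
    (h : ∀ᵐ t ∂(muT T), g t u₀ ≤ g₀) :
    IsUpperFunction T φ F g g₀ (fun _ => u₀) fun _ => 0 := by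
  refine ⟨isC1Periodic_const T u₀, fun a ha b hb hab => ?_⟩
  rw [sub_self]
  refine intervalIntegral.integral_nonneg_of_ae_restrict hab ?_
  filter_upwards [ae_restrict_of_ae_restrict_of_subset (Icc_subset_Icc ha.1 hb.2) h] with t ht
  simpa using ht

/-- Limits of uniformly bounded periodic solutions are periodic solutions. -/
theorem exists_solution_of_tendsto (hT : 0 < T) (hφ : StrictMono φ) (hφc : Continuous φ)
    (hφs : Function.Surjective φ) (hφ0 : φ 0 = 0) (hf : Continuous f) (hg : Caratheodory T g)
    {u : ℕ → ℝ → ℝ} {σ : ℕ → ℝ} (hu : ∀ n, IsSolEs T φ f g (σ n) (u n))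
    (hσ : Tendsto σ atTop (𝓝 s)) {S : ℝ} (hS : ∀ n, |σ n| ≤ S) (hD : 0 ≤ D)
    (huD : ∀ n, ∀ t ∈ Icc 0 T, |u n t| ≤ D) : ∃ v, IsSolEs T φ f g s v := by
  obtain ⟨ψ, hψ, hψm, hφψ, hψφ, hψ0⟩ := exists_continuous_inverse hφ hφs hφ0
  have hF := hasDerivAt_primitive hf
  obtain ⟨A, L, hL, hA, hFL⟩ := exists_bounds_truncated_friction hf hF hD
  have hF' := hasDerivAt_truncated_primitive hF D
  have hFc := continuous_iff_continuousAt.2 fun x => (hF' x).continuousAt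
  have hfc := continuous_truncated_friction hf D
  obtain ⟨h, γ, H, hh, -, -⟩ := hg.exists_truncation hD
  have h0I : (0:ℝ) ∈ Icc 0 T := ⟨le_rfl, hT.le⟩
  have hTI : T ∈ Icc 0 T := ⟨hT.le, le_rfl⟩
  choose x z hxu hx hx0 hz0 using fun n =>
    ((hu n).truncate hh (huD n)).exists_orbit hT hφc hψφ hfc hF'
  obtain ⟨v, w, k, hk, hvw, hv, hw⟩ := exists_limit_orbit hT.le hψ hFc hA H hx
    (fun _ => le_rfl) tendsto_const_nhds hσ (R := max D (A + (S * T + ∫ τ, γ τ)))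
    (fun n => by rw [hxu n h0I]; exact (huD n 0 h0I).trans (le_max_left _ _))
    (fun n => ((hx n).abs_momentum_zero_le hT hψ hψm hψ0 hFc hA H (hS n) (hx0 n)).trans
      (le_max_right _ _))
  have hv0 : v 0 = v T := by
    refine tendsto_nhds_unique (hv.tendsto_at h0I) ?_
    simpa only [hx0] using hv.tendsto_at hTI
  have hw0 : w 0 = w T := by
    refine tendsto_nhds_unique (hw.tendsto_at h0I) ?_
    simpa only [hz0] using hw.tendsto_at hTI
  refine ⟨v, (hvw.isSolEs hT hψ hφψ hfc hF' H hv0 hw0).untruncate hh fun t ht => ?_⟩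
  refine le_of_tendsto (hv.tendsto_at ht).abs (Eventually.of_forall fun n => ?_)
  rw [hxu (k n) ht]
  exact huD (k n) t ht

end

/-- Ambrosetti–Prodi alternative under `(H₀)`, `(Hᴵ₁)`, `(Hᴵ₂)`, `(Hᴵ₃)` (and `(Hᴵ₄)`). -/
theorem statement8
    (T : ℝ) (hT : 0 < T)
    (φ f : ℝ → ℝ)
    (hφmono : StrictMono φ) (hφcont : Continuous φ)
    (hφsurj : Function.Surjective φ) (hφ0 : φ 0 = 0)
    (hf : Continuous f)
    (g : ℝ → ℝ → ℝ) (hCar : Caratheodory T g)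
    (hH0 : CondA0 T g)
    (hH1 : ∃ γ₀ : ℝ → ℝ, IntegrableOn γ₀ (Icc (0:ℝ) T) ∧
      (∀ᵐ t ∂(muT T), 0 ≤ γ₀ t) ∧ ∀ᵐ t ∂(muT T), ∀ u : ℝ, -γ₀ t ≤ g t u)
    (u₀ g₀ : ℝ) (hH2 : ∀ᵐ t ∂(muT T), g t u₀ ≤ g₀)
    (hH3 : ∃ σ : ℝ, HI3 T g g₀ σ) :
    ∃ s₀ : ℝ, (s₀ : EReal) < sigmaStar T g g₀ ∧
      (∀ s : ℝ, s₀ < s → (s : EReal) < sigmaStar T g g₀ →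
        ∃ u : ℝ → ℝ, IsSolEs T φ f g s u) ∧
      (∀ s : ℝ, s < s₀ → ¬∃ u : ℝ → ℝ, IsSolEs T φ f g s u) ∧
      ((∃ σ : ℝ, HI4 T g g₀ σ) →
        (∃ u : ℝ → ℝ, IsSolEs T φ f g s₀ u) ∧
        ∀ s : ℝ, s₀ < s → (s : EReal) < sigmaStarStar T g g₀ →
          ∃ u₁ u₂ : ℝ → ℝ, IsSolEs T φ f g s u₁ ∧ IsSolEs T φ f g s u₂ ∧
            ∃ t ∈ Icc (0:ℝ) T, u₁ t ≠ u₂ t) := by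
  obtain ⟨γ₀, hγ, hγ0, hgγ⟩ := hH1
  have hF := hasDerivAt_primitive hf
  set Z : Set ℝ := {s | ∃ u, IsSolEs T φ f g s u} with hZ
  have hbelow : ∀ s σ s' : ℝ, ∀ β β' : ℝ → ℝ, HI3 T g g₀ σ → s < σ → s' < s →
      IsUpperFunction T φ (fun x => ∫ y in (0:ℝ)..x, f y) g s' β β' →
      ∃ u, IsSolEs T φ f g s u ∧ ∀ t ∈ Icc 0 T, u t < β t := by
    rintro s σ s' β β' ⟨-, d, hd, hσ⟩ hsσ hs' hβ
    exact exists_solution_lt hT hφmono hφsurj hφ0 hf hF hCar hH0 hγ hγ0 hgγ hd.le hσ hsσ.le hs' hβ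
  have hconst : ∀ s σ : ℝ, HI3 T g g₀ σ → g₀ < s → s < σ → s ∈ Z := by
    intro s σ hσ hs hsσ
    obtain ⟨u, hu, -⟩ := hbelow s σ g₀ _ _ hσ hsσ hs (isUpperFunction_const hH2)
    exact ⟨u, hu⟩
  have hbdd : BddBelow Z := by
    refine ⟨-(∫ t in Icc 0 T, γ₀ t) / T, ?_⟩
    rintro s ⟨u, hu⟩
    obtain ⟨hi, he⟩ := hu.integral_eq hT hf
    rw [div_le_iff₀ hT, ← he, ← integral_neg]
    exact integral_mono_ae hγ.neg hi (hgγ.mono fun t ht => ht (u t))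
  obtain ⟨σ₁, hσ₁⟩ := hH3
  have hinf : ∀ σ, max 0 g₀ < σ → sInf Z < σ := by
    intro σ hσ
    have h1 : max 0 g₀ < min σ σ₁ := lt_min hσ hσ₁.1
    have h2 : g₀ ≤ max 0 g₀ := le_max_right _ _
    have h3 : min σ σ₁ ≤ σ := min_le_left _ _
    have h4 : min σ σ₁ ≤ σ₁ := min_le_right _ _
    have := csInf_le hbdd (hconst ((max 0 g₀ + min σ σ₁) / 2) σ₁ hσ₁ (by linarith) (by linarith))
    linarith
  have hne : Z.Nonempty := by
    have h1 := hσ₁.1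
    have h2 : g₀ ≤ max 0 g₀ := le_max_right _ _
    exact ⟨_, hconst ((g₀ + σ₁) / 2) σ₁ hσ₁ (by linarith) (by linarith)⟩
  have hupper : ∀ s, sInf Z < s → ∃ s' < s, ∃ β β',
      IsUpperFunction T φ (fun x => ∫ y in (0:ℝ)..x, f y) g s' β β' := by
    intro s hs
    obtain ⟨s', ⟨β, hβ⟩, hs'⟩ := exists_lt_of_csInf_lt hne hs
    obtain ⟨β', hβ'⟩ := hβ.exists_isUpperFunction hf hF
    exact ⟨s', hs', β, β', hβ'⟩
  have hstar : ∀ s : ℝ, (s : EReal) < sigmaStar T g g₀ → ∃ σ, HI3 T g g₀ σ ∧ s < σ := by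
    intro s hs
    obtain ⟨-, ⟨σ, rfl, hσ⟩, hlt⟩ := lt_sSup_iff.1 hs
    exact ⟨σ, hσ, EReal.coe_lt_coe_iff.1 hlt⟩
  refine ⟨sInf Z, ?_, ?_, ?_, ?_⟩
  · exact (EReal.coe_lt_coe_iff.2 (hinf σ₁ hσ₁.1)).trans_le (le_sSup ⟨σ₁, rfl, hσ₁⟩)
  · intro s hs hsσ
    obtain ⟨σ, hσ, hlt⟩ := hstar s hsσ
    obtain ⟨s', hs', β, β', hβ⟩ := hupper s hs
    obtain ⟨u, hu, -⟩ := hbelow s σ s' β β' hσ hlt hs' hβ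
    exact ⟨u, hu⟩
  · intro s hs hsol
    exact hs.not_ge (csInf_le hbdd hsol)
  · rintro ⟨σ₂, hσ₂⟩
    refine ⟨?_, ?_⟩
    · obtain ⟨hσ₁0, d, hd, hmean⟩ := hσ₁
      obtain ⟨hσ₂0, e, he, hmean'⟩ := hσ₂
      have hex : ∀ n : ℕ, ∃ s ∈ Z, s < min (sInf Z + 1 / ((n:ℝ) + 1)) (min σ₁ σ₂) := fun n =>
        exists_lt_of_csInf_lt hne
          (lt_min (lt_add_of_pos_right _ (by positivity)) (lt_min (hinf _ hσ₁0) (hinf _ hσ₂0)))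
      choose σ hσZ hσlt using hex
      choose u hu using hσZ
      have hge : ∀ n, sInf Z ≤ σ n := fun n => csInf_le hbdd ⟨u n, hu n⟩
      have hlt1 : ∀ n, σ n ≤ sInf Z + 1 / ((n:ℝ) + 1) := fun n =>
        (hσlt n).le.trans (min_le_left _ _)
      have hlim : Tendsto σ atTop (nhds (sInf Z)) := by
        refine tendsto_of_tendsto_of_tendsto_of_le_of_le tendsto_const_nhds ?_ hge hlt1
        simpa using tendsto_one_div_add_atTop_nhds_zero_nat.const_add (sInf Z)
      have hS : ∀ n, |σ n| ≤ |sInf Z| + 1 := by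
        intro n
        have h1 : 1 / ((n:ℝ) + 1) ≤ 1 := by
          rw [div_le_one (by positivity)]
          linarith [(Nat.cast_nonneg n : (0:ℝ) ≤ n)]
        rw [abs_le]
        constructor <;>
          linarith [hge n, hlt1 n, neg_abs_le (sInf Z), le_abs_self (sInf Z)]
      obtain ⟨R, hR0, hR⟩ := exists_oscillation_bound hT hφmono hφsurj hφ0 hγ hγ0 (|sInf Z| + 1)
      refine exists_solution_of_tendsto hT hφmono hφcont hφsurj hφ0 hf hCar hu hlim hS
        (D := d + e + R) (by positivity) fun n t ht => ?_
      have hosc := hR f g (σ n) (u n) hf (hS n) hgγ (hu n)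
      have h1 := (hu n).lower_bound hT hf
        ((hσlt n).le.trans ((min_le_right _ _).trans (min_le_left _ _))) hmean hosc ht
      have h2 := (hu n).upper_bound hT hf
        ((hσlt n).le.trans ((min_le_right _ _).trans (min_le_right _ _))) hmean' hosc ht
      rw [abs_le]
      constructor <;> linarith
    · intro s hs hss
      obtain ⟨-, ⟨ρ, rfl, hρ, hρle⟩, hlt⟩ := lt_sSup_iff.1 hss
      obtain ⟨σ, hσ, hsσ⟩ := hstar s (hlt.trans_le hρle)
      obtain ⟨s', hs', β, β', hβ⟩ := hupper s hs
      obtain ⟨u₁, hu₁, hlt₁⟩ := hbelow s σ s' β β' hσ hsσ hs' hβ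
      obtain ⟨-, d, hd, hmean⟩ := hσ
      obtain ⟨-, e, he, hmean'⟩ := hρ
      obtain ⟨u₂, hu₂, t, ht, hgt⟩ := exists_solution_gt hT hφmono hφsurj hφ0 hf hF hCar hH0 hγ
        hγ0 hgγ hd.le hmean hsσ.le he.le hmean' (EReal.coe_lt_coe_iff.1 hlt).le hs' hβ
      exact ⟨u₁, u₂, hu₁, hu₂, t, ht, ((hlt₁ t ht).trans hgt).ne⟩
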